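/- arXiv:0808.2692 — 5 statements merged into one kernel-verified Lean document; each statement's English description precedes it below -/
import Mathlib

section
/- ∫₀^∞ x ( (γ sinh(γx)/cosh²(γx)) e^{-x²/π²} + (√π sinh(x)/cosh²(x)) e^{-γ²x²} ) dx = ∫₀^∞ e^{-x²/π²}/cosh(γx) dx, where γ is the Euler–Mascheroni constant. -/
open Real MeasureTheory

lemma sigmoid_two_mul (x : ℝ) : sigmoid (2 * x) = rexp x / (2 * cosh x) := by
  have h : rexp (-(2 * x)) = rexp (-x) * rexp (-x) := by rw [← exp_add]; ring_nf
  have h' : rexp x * rexp (-x) = 1 := by rw [← exp_add]; simp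
  rw [sigmoid_def, cosh_eq, h]
  have := exp_pos x
  have := exp_pos (-x)
  field_simp
  linear_combination -rexp (-x) * h'

lemma one_sub_sigmoid_two_mul (x : ℝ) : 1 - sigmoid (2 * x) = rexp (-x) / (2 * cosh x) := by
  rw [← sigmoid_neg, ← mul_neg, sigmoid_two_mul, cosh_neg]

lemma deriv_sigmoid_smul_betaIntegrand (s : ℂ) (v : ℝ) :
    |2 * π * (sigmoid (2 * (π * v)) * (1 - sigmoid (2 * (π * v))))| •
      ((sigmoid (2 * (π * v)) : ℂ) ^ (s - 1) *
        (1 - (sigmoid (2 * (π * v)) : ℂ)) ^ ((1 - s) - 1)) =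
    π * (Complex.exp (π * v * (2 * s - 1)) * ((1 / cosh (π * v) : ℝ) : ℂ)) := by
  have hc : 0 < 2 * cosh (π * v) := by have := cosh_pos (π * v); positivity
  obtain ⟨L, hL⟩ : ∃ L, rexp L = 2 * cosh (π * v) := ⟨_, exp_log hc⟩
  have h1 : sigmoid (2 * (π * v)) = rexp (π * v - L) := by
    rw [sigmoid_two_mul, exp_sub, hL]
  have h2 : 1 - sigmoid (2 * (π * v)) = rexp (-(π * v) - L) := by
    rw [one_sub_sigmoid_two_mul, exp_sub, hL]
  have h3 : 1 / cosh (π * v) = 2 * rexp (-L) := by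
    have := cosh_pos (π * v)
    rw [exp_neg, hL]; field_simp
  have h2' : (1 : ℂ) - (sigmoid (2 * (π * v)) : ℂ) = ((rexp (-(π * v) - L) : ℝ) : ℂ) := by
    rw [← h2]; push_cast; ring
  have hpow (y : ℝ) (w : ℂ) : ((rexp y : ℝ) : ℂ) ^ w = Complex.exp (y * w) := by
    rw [Complex.cpow_def_of_ne_zero (by exact_mod_cast (exp_pos y).ne'),
      ← Complex.ofReal_log (exp_pos y).le, log_exp]
  rw [h2', h2, h1, h3, abs_of_pos (by positivity), hpow, hpow, Complex.real_smul]
  push_cast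
  rw [← Complex.exp_add, ← Complex.exp_add]
  have e1 (a b c : ℂ) : 2 * (π : ℂ) * Complex.exp a * Complex.exp b =
      2 * π * Complex.exp (a + b) := by rw [Complex.exp_add]; ring
  have e2 (a b : ℂ) : (π : ℂ) * (Complex.exp a * (2 * Complex.exp b)) =
      2 * π * Complex.exp (a + b) := by rw [Complex.exp_add]; ring
  rw [e1 _ _ 0, e2]
  ring_nf

lemma image_sigmoid_two_pi : (fun v : ℝ ↦ sigmoid (2 * (π * v))) '' Set.univ = Set.Ioo 0 1 := by
  rw [Set.image_univ, ← range_sigmoid]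
  refine Function.Surjective.range_comp (f := fun v : ℝ ↦ 2 * (π * v)) (fun y ↦ ?_) sigmoid
  exact ⟨y / (2 * π), by have := pi_pos; field_simp⟩

lemma injective_sigmoid_two_pi : Function.Injective fun v : ℝ ↦ sigmoid (2 * (π * v)) := by
  intro a b h
  simpa [pi_ne_zero] using sigmoid_injective h

lemma hasDerivAt_sigmoid_two_pi (v : ℝ) : HasDerivAt (fun v : ℝ ↦ sigmoid (2 * (π * v)))
    (2 * π * (sigmoid (2 * (π * v)) * (1 - sigmoid (2 * (π * v))))) v := by
  have := (hasDerivAt_sigmoid (2 * (π * v))).comp v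
    (((hasDerivAt_id v).const_mul π).const_mul 2)
  refine this.congr_deriv ?_
  simp; ring

lemma integral_cexp_mul_sech {s : ℂ} (h0 : 0 < s.re) (h1 : s.re < 1) :
    Integrable (fun v : ℝ ↦ Complex.exp (π * v * (2 * s - 1)) * ((1 / cosh (π * v) : ℝ) : ℂ)) ∧
    ∫ v : ℝ, Complex.exp (π * v * (2 * s - 1)) * ((1 / cosh (π * v) : ℝ) : ℂ) =
      1 / Complex.sin (π * s) := by
  have hπ : (π : ℂ) ≠ 0 := by exact_mod_cast pi_ne_zero
  have h1' : 0 < (1 - s).re := by simpa using h1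
  have hd : ∀ v ∈ (Set.univ : Set ℝ), HasDerivWithinAt (fun v : ℝ ↦ sigmoid (2 * (π * v)))
    (2 * π * (sigmoid (2 * (π * v)) * (1 - sigmoid (2 * (π * v))))) Set.univ v :=
    fun v _ ↦ (hasDerivAt_sigmoid_two_pi v).hasDerivWithinAt
  have hi := injective_sigmoid_two_pi.injOn (s := Set.univ)
  constructor
  · have := (intervalIntegrable_iff_integrableOn_Ioo_of_le zero_le_one).1
      (Complex.betaIntegral_convergent h0 h1')
    rw [← image_sigmoid_two_pi,
      integrableOn_image_iff_integrableOn_abs_deriv_smul MeasurableSet.univ hd hi] at this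
    simp only [deriv_sigmoid_smul_betaIntegrand, integrableOn_univ] at this
    simpa [hπ] using this.const_mul (π : ℂ)⁻¹
  · have hB := Complex.Gamma_mul_Gamma_eq_betaIntegral h0 h1'
    rw [Complex.Gamma_mul_Gamma_one_sub, Complex.betaIntegral, add_sub_cancel, Complex.Gamma_one,
      one_mul, intervalIntegral.integral_of_le zero_le_one, integral_Ioc_eq_integral_Ioo,
      ← image_sigmoid_two_pi,
      integral_image_eq_integral_abs_deriv_smul MeasurableSet.univ hd hi] at hB
    simp only [deriv_sigmoid_smul_betaIntegrand, setIntegral_univ] at hB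
    rw [integral_const_mul] at hB
    apply mul_left_cancel₀ hπ
    rw [← hB]; ring

lemma integrable_sech_pi : Integrable (fun v : ℝ ↦ ((1 / cosh (π * v) : ℝ) : ℂ)) := by
  simpa using (integral_cexp_mul_sech (s := 1 / 2) (by norm_num) (by norm_num)).1

open FourierTransform in
lemma fourier_sech_pi :
    𝓕 (fun v : ℝ ↦ ((1 / cosh (π * v) : ℝ) : ℂ)) = fun w ↦ ((1 / cosh (π * w) : ℝ) : ℂ) := by
  ext w
  rw [Real.fourier_real_eq_integral_exp_smul]
  have h := (integral_cexp_mul_sech (s := 1 / 2 - w * Complex.I) (by simp) (by norm_num)).2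
  have hs : Complex.sin (π * (1 / 2 - w * Complex.I)) = (cosh (π * w) : ℝ) := by
    rw [show (π : ℂ) * (1 / 2 - w * Complex.I) = π / 2 - π * w * Complex.I by ring,
      Complex.sin_pi_div_two_sub, Complex.cos_mul_I]
    push_cast; rfl
  rw [hs] at h
  push_cast at h ⊢
  rw [← h]
  congr 1
  ext v
  rw [smul_eq_mul]
  ring_nf

open FourierTransform in
/-- Parseval's identity for a Gaussian against the self-dual function `v ↦ 1 / cosh (π v)`. -/
lemma integral_gaussian_mul_sech_pi {b : ℝ} (hb : 0 < b) :
    (1 / √b) * ∫ x : ℝ, rexp (-(π / b) * x ^ 2) / cosh (π * x) =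
      ∫ x : ℝ, rexp (-(π * b) * x ^ 2) / cosh (π * x) := by
  have hg : Integrable (fun x : ℝ ↦ Complex.exp (-π * b * (x : ℂ) ^ 2)) := by
    have := (integrable_exp_neg_mul_sq (mul_pos pi_pos hb)).ofReal (𝕜 := ℂ)
    refine this.congr (.of_forall fun x ↦ ?_)
    simp
  have hP := VectorFourier.integral_fourierIntegral_smul_eq_flip (e := Real.fourierChar)
    (L := innerₗ ℝ) Real.continuous_fourierChar continuous_inner hg integrable_sech_pi
  rw [flip_innerₗ] at hP
  change ∫ ξ : ℝ, (𝓕 (fun x : ℝ ↦ Complex.exp (-π * b * (x : ℂ) ^ 2))) ξ • _ =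
    ∫ x : ℝ, _ • (𝓕 (fun v : ℝ ↦ ((1 / cosh (π * v) : ℝ) : ℂ))) x at hP
  rw [fourier_sech_pi, fourier_gaussian_pi (by simpa using hb)] at hP
  have hsq : (b : ℂ) ^ (1 / 2 : ℂ) = (√b : ℝ) := by
    rw [sqrt_eq_rpow, Complex.ofReal_cpow hb.le]; norm_num
  rw [hsq] at hP
  rw [← integral_const_mul]
  rw [← Complex.ofReal_inj, ← integral_complex_ofReal, ← integral_complex_ofReal]
  convert hP using 3 with x x
  · push_cast
    simp only [smul_eq_mul]; ring_nf
  · push_cast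
    simp only [smul_eq_mul]; ring_nf

/-- The half-line integral of a Gaussian against `x ↦ 1 / cosh (a x)`. -/
noncomputable def gaussSech (c a : ℝ) : ℝ :=
  ∫ x in Set.Ioi (0 : ℝ), rexp (-c * x ^ 2) / cosh (a * x)

lemma integral_gaussian_div_cosh (c a : ℝ) :
    ∫ x : ℝ, rexp (-c * x ^ 2) / cosh (a * x) = 2 * gaussSech c a := by
  rw [gaussSech, ← integral_comp_abs (f := fun x ↦ rexp (-c * x ^ 2) / cosh (a * x))]
  congr 1
  ext x
  rcases abs_choice x with h | h <;> simp [h]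

lemma gaussSech_scale (c a : ℝ) {s : ℝ} (hs : 0 < s) :
    gaussSech c a = s * gaussSech (c * s ^ 2) (a * s) := by
  have := integral_comp_mul_left_Ioi (fun x ↦ rexp (-c * x ^ 2) / cosh (a * x)) 0 hs
  rw [mul_zero, smul_eq_mul] at this
  rw [gaussSech, gaussSech, eq_comm, ← eq_inv_mul_iff_mul_eq₀ hs.ne', ← this]
  congr 1
  ext x
  ring_nf

lemma mul_gaussSech_eq {a : ℝ} (ha : 0 < a) :
    a * gaussSech (1 / π ^ 2) a = √π * gaussSech 1 a⁻¹ := by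
  have hπ := pi_pos
  have h := integral_gaussian_mul_sech_pi (b := π * a ^ 2) (by positivity)
  rw [integral_gaussian_div_cosh, integral_gaussian_div_cosh,
    gaussSech_scale (π / (π * a ^ 2)) π (s := a / π) (by positivity),
    gaussSech_scale (π * (π * a ^ 2)) π (s := 1 / (π * a)) (by positivity),
    show π / (π * a ^ 2) * (a / π) ^ 2 = 1 / π ^ 2 by field_simp,
    show π * (a / π) = a by field_simp,
    show π * (π * a ^ 2) * (1 / (π * a)) ^ 2 = 1 by field_simp,
    show π * (1 / (π * a)) = a⁻¹ by field_simp,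
    sqrt_mul hπ.le, sqrt_sq ha.le] at h
  have hs : 0 < √π := sqrt_pos.2 hπ
  field_simp at h
  simpa using h

lemma abs_sinh_div_cosh_sq_le (x : ℝ) : |sinh x / cosh x ^ 2| ≤ 1 := by
  have h1 := one_le_cosh x
  have h2 : |sinh x| ≤ cosh x := by
    exact abs_le_of_sq_le_sq (by nlinarith [cosh_sq x]) (cosh_pos x).le
  rw [abs_div, abs_of_pos (by positivity : 0 < cosh x ^ 2), div_le_one (by positivity)]
  nlinarith

lemma hasDerivAt_gaussSech {c : ℝ} (hc : 0 < c) (a : ℝ) :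
    Integrable (fun x ↦ -(x * (sinh (a * x) / cosh (a * x) ^ 2) * rexp (-c * x ^ 2)))
      (volume.restrict (Set.Ioi 0)) ∧
    HasDerivAt (gaussSech c)
      (∫ x in Set.Ioi (0 : ℝ), -(x * (sinh (a * x) / cosh (a * x) ^ 2) * rexp (-c * x ^ 2))) a := by
  have hne (y : ℝ) : cosh y ≠ 0 := (cosh_pos y).ne'
  have hcont (a : ℝ) : Continuous fun x ↦ rexp (-c * x ^ 2) / cosh (a * x) := by
    refine Continuous.div (by fun_prop) (by fun_prop) fun x ↦ hne _
  refine hasDerivAt_integral_of_dominated_loc_of_deriv_le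
    (F := fun a x ↦ rexp (-c * x ^ 2) / cosh (a * x))
    (F' := fun a x ↦ -(x * (sinh (a * x) / cosh (a * x) ^ 2) * rexp (-c * x ^ 2)))
    (bound := fun x ↦ |x * rexp (-c * x ^ 2)|) Filter.univ_mem
    (.of_forall fun a ↦ (hcont a).aestronglyMeasurable) ?_ ?_ ?_ ?_ ?_
  · refine (integrable_exp_neg_mul_sq hc).integrableOn.mono' (hcont a).aestronglyMeasurable
      (.of_forall fun x ↦ ?_)
    rw [norm_div, norm_of_nonneg (exp_pos _).le, norm_of_nonneg (cosh_pos _).le]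
    exact div_le_self (exp_pos _).le (one_le_cosh _)
  · refine Continuous.aestronglyMeasurable ?_
    refine Continuous.neg (.mul (.mul continuous_id (.div (by fun_prop) (by fun_prop) ?_))
      (by fun_prop))
    exact fun x ↦ pow_ne_zero _ (hne _)
  · refine .of_forall fun x a _ ↦ ?_
    rw [norm_neg, norm_eq_abs, abs_mul, abs_mul, abs_mul]
    gcongr
    exact mul_le_of_le_one_right (abs_nonneg _) (abs_sinh_div_cosh_sq_le _)
  · exact (integrable_mul_exp_neg_mul_sq hc).abs.integrableOn
  · refine .of_forall fun x a _ ↦ ?_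
    have h := (((hasDerivAt_id a).mul_const x).cosh.inv (hne _)).const_mul (rexp (-c * x ^ 2))
    simp only [id, one_mul] at h
    refine h.congr_deriv ?_
    ring

lemma integral_sinh_div_cosh_sq_gaussian {a : ℝ} (ha : 0 < a) :
    ∫ x in Set.Ioi (0 : ℝ), x * ((a * sinh (a * x) / cosh (a * x) ^ 2) * rexp (-x ^ 2 / π ^ 2) +
        (√π * sinh x / cosh x ^ 2) * rexp (-a ^ 2 * x ^ 2)) =
      ∫ x in Set.Ioi (0 : ℝ), rexp (-x ^ 2 / π ^ 2) / cosh (a * x) := by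
  have hπ := pi_pos
  obtain ⟨i1, d1⟩ := hasDerivAt_gaussSech (c := 1 / π ^ 2) (by positivity) a
  obtain ⟨-, d2⟩ := hasDerivAt_gaussSech one_pos a⁻¹
  obtain ⟨i3, -⟩ := hasDerivAt_gaussSech (c := a ^ 2) (by positivity) 1
  have hd1 := (hasDerivAt_id a).mul d1
  have hd2 := (d2.comp a (hasDerivAt_inv ha.ne')).const_mul √π
  have heq := (hd1.congr_of_eventuallyEq (f₁ := fun t ↦ √π * gaussSech 1 t⁻¹) (by
    filter_upwards [lt_mem_nhds ha] with t ht
    exact (mul_gaussSech_eq ht).symm)).unique hd2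
  have hscale := integral_comp_mul_left_Ioi
    (fun x ↦ -(x * (sinh (a⁻¹ * x) / cosh (a⁻¹ * x) ^ 2) * rexp (-1 * x ^ 2))) 0 ha
  rw [mul_zero, smul_eq_mul, eq_inv_mul_iff_mul_eq₀ ha.ne'] at hscale
  have hscale' : ∀ x, -(a * x * (sinh (a⁻¹ * (a * x)) / cosh (a⁻¹ * (a * x)) ^ 2) *
      rexp (-1 * (a * x) ^ 2)) =
      a * -(x * (sinh (1 * x) / cosh (1 * x) ^ 2) * rexp (-a ^ 2 * x ^ 2)) := fun x ↦ by
    rw [inv_mul_cancel_left₀ ha.ne']; ring_nf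
  simp only [hscale'] at hscale
  rw [integral_const_mul] at hscale
  rw [← hscale] at heq
  have hL : ∀ x, x * ((a * sinh (a * x) / cosh (a * x) ^ 2) * rexp (-x ^ 2 / π ^ 2) +
        (√π * sinh x / cosh x ^ 2) * rexp (-a ^ 2 * x ^ 2)) =
      -a * -(x * (sinh (a * x) / cosh (a * x) ^ 2) * rexp (-(1 / π ^ 2) * x ^ 2)) +
      -√π * -(x * (sinh (1 * x) / cosh (1 * x) ^ 2) * rexp (-a ^ 2 * x ^ 2)) := fun x ↦ by
    ring_nf
  have hR : ∫ x in Set.Ioi (0 : ℝ), rexp (-x ^ 2 / π ^ 2) / cosh (a * x) =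
      gaussSech (1 / π ^ 2) a := by
    rw [gaussSech]; congr 1; ext x; ring_nf
  simp only [hL]
  rw [integral_add (i1.const_mul _) (i3.const_mul _), integral_const_mul, integral_const_mul, hR]
  simp only [id, one_mul] at heq
  field_simp at heq
  simp only [one_mul]
  field_simp
  linarith

theorem russell_integral_0 :
    ∫ x in Set.Ioi (0:ℝ),
      x * ((eulerMascheroniConstant * Real.sinh (eulerMascheroniConstant * x) /
              (Real.cosh (eulerMascheroniConstant * x))^2) * Real.exp (-x^2 / π^2) +
           (Real.sqrt π * Real.sinh x / (Real.cosh x)^2) *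
              Real.exp (-eulerMascheroniConstant^2 * x^2)) =
    ∫ x in Set.Ioi (0:ℝ), Real.exp (-x^2 / π^2) / Real.cosh (eulerMascheroniConstant * x) := by
  exact integral_sinh_div_cosh_sq_gaussian
    (one_half_pos.trans one_half_lt_eulerMascheroniConstant)
end

section
/- ∫₀^∞ x ( (1/π) e^{-x²/π²} + (1/√π) e^{-x²} ) (sinh(x)/cosh²(x)) dx = ∫₀^∞ e^{-x²}/cosh(πx) dx. -/
open Real MeasureTheory

/-- The logistic substitution `t = sigmoid (2πx)` in the Beta integrand. -/
lemma sigmoid_beta_integrand (w x : ℝ) :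
    |2 * π * (sigmoid (2 * π * x) * (1 - sigmoid (2 * π * x)))| •
      ((sigmoid (2 * π * x) : ℂ) ^ ((1 / 2 - Complex.I * w : ℂ) - 1) *
        (1 - (sigmoid (2 * π * x) : ℂ)) ^ ((1 / 2 + Complex.I * w : ℂ) - 1)) =
      (π : ℂ) * (Complex.exp (↑(-2 * π * x * w) * Complex.I) • ((1 / cosh (π * x) : ℝ) : ℂ)) := by
  have hc : 0 < cosh (π * x) := cosh_pos _
  have hE : 0 < exp (π * x) := exp_pos _
  have h1 : sigmoid (2 * π * x) = exp (π * x - log (2 * cosh (π * x))) := by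
    rw [exp_sub, exp_log (by positivity), sigmoid_def, cosh_eq,
      show -(2 * π * x) = -(π * x) + -(π * x) by ring, exp_add, exp_neg]
    field_simp
  have h2 : 1 - sigmoid (2 * π * x) = exp (-(π * x) - log (2 * cosh (π * x))) := by
    rw [← sigmoid_neg, exp_sub, exp_log (by positivity), sigmoid_def, cosh_eq,
      show -(-(2 * π * x)) = (π * x) + (π * x) by ring, exp_add, exp_neg]
    field_simp
    ring
  have key (a : ℝ) (z : ℂ) : ((exp a : ℝ) : ℂ) ^ z = Complex.exp (a * z) := by
    rw [Complex.cpow_def_of_ne_zero (by exact_mod_cast (exp_pos a).ne'), ← Complex.ofReal_log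
      (exp_pos a).le, log_exp]
  have h3 : (1 : ℂ) - (sigmoid (2 * π * x) : ℂ) = ((1 - sigmoid (2 * π * x) : ℝ) : ℂ) := by
    push_cast; rfl
  have h4 : 2 * π * (exp (π * x - log (2 * cosh (π * x))) *
      exp (-(π * x) - log (2 * cosh (π * x)))) = 2 * π / (2 * cosh (π * x)) ^ 2 := by
    rw [← exp_add, show π * x - log (2 * cosh (π * x)) + (-(π * x) - log (2 * cosh (π * x))) =
      -(log (2 * cosh (π * x)) + log (2 * cosh (π * x))) by ring, exp_neg, exp_add,
      exp_log (by positivity)]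
    ring
  rw [h3, h2, h1, h4, abs_of_pos (by positivity), key, key, ← Complex.exp_add,
    show ((π * x - log (2 * cosh (π * x)) : ℝ) : ℂ) * (1 / 2 - Complex.I * w - 1) +
      ((-(π * x) - log (2 * cosh (π * x)) : ℝ) : ℂ) * (1 / 2 + Complex.I * w - 1) =
      ((-2 * π * x * w : ℝ) : ℂ) * Complex.I + (log (2 * cosh (π * x)) : ℝ) by push_cast; ring,
    Complex.exp_add, ← Complex.ofReal_exp, exp_log (by positivity), Complex.real_smul, smul_eq_mul]
  have hc' : ((cosh (π * x) : ℝ) : ℂ) ≠ 0 := by exact_mod_cast hc.ne'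
  push_cast at hc' ⊢
  field_simp

lemma hasDerivAt_sigmoid_two_pi_mul (x : ℝ) :
    HasDerivAt (fun x ↦ sigmoid (2 * π * x))
      (2 * π * (sigmoid (2 * π * x) * (1 - sigmoid (2 * π * x)))) x := by
  have := (hasDerivAt_sigmoid (2 * π * x)).comp x ((hasDerivAt_id x).const_mul (2 * π))
  simpa [Function.comp_def, mul_comm, mul_assoc, mul_left_comm] using this

lemma injective_sigmoid_two_pi_mul : Function.Injective (fun x ↦ sigmoid (2 * π * x)) := by
  intro x y h
  have := sigmoid_injective h
  have hp := pi_pos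
  exact mul_left_cancel₀ (by positivity) this

lemma image_sigmoid_two_pi_mul : (fun x ↦ sigmoid (2 * π * x)) '' Set.univ = Set.Ioo 0 1 := by
  have hp := pi_pos
  rw [Set.image_univ, ← range_sigmoid]
  exact (mul_left_surjective₀ (a := 2 * π) (by positivity)).range_comp sigmoid

lemma integrable_one_div_cosh_pi_mul : Integrable (fun x : ℝ ↦ 1 / cosh (π * x)) := by
  have h := Complex.betaIntegral_convergent (u := 1 / 2 - Complex.I * (0 : ℝ))
    (v := 1 / 2 + Complex.I * (0 : ℝ)) (by norm_num) (by norm_num)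
  rw [intervalIntegrable_iff_integrableOn_Ioo_of_le zero_le_one, ← image_sigmoid_two_pi_mul,
    integrableOn_image_iff_integrableOn_abs_deriv_smul MeasurableSet.univ
      (fun x _ ↦ (hasDerivAt_sigmoid_two_pi_mul x).hasDerivWithinAt)
      injective_sigmoid_two_pi_mul.injOn, integrableOn_univ] at h
  simp_rw [sigmoid_beta_integrand] at h
  have h' := (h.const_mul (π : ℂ)⁻¹).re
  refine h'.congr (Filter.Eventually.of_forall fun x ↦ ?_)
  have : (π : ℂ) ≠ 0 := by exact_mod_cast pi_ne_zero
  dsimp only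
  rw [inv_mul_cancel_left₀ this]
  simp only [mul_zero, Complex.ofReal_zero, zero_mul, Complex.exp_zero, one_smul]
  exact Complex.ofReal_re _

open FourierTransform in
/-- The function `x ↦ 1 / cosh (πx)` is its own Fourier transform. -/
lemma fourier_one_div_cosh_pi_mul :
    𝓕 (fun x : ℝ ↦ ((1 / cosh (π * x) : ℝ) : ℂ)) = fun x : ℝ ↦ ((1 / cosh (π * x) : ℝ) : ℂ) := by
  ext w
  have hpi : (π : ℂ) ≠ 0 := by exact_mod_cast pi_ne_zero
  have hu : 0 < (1 / 2 - Complex.I * w : ℂ).re := by norm_num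
  have hv : 0 < (1 / 2 + Complex.I * w : ℂ).re := by norm_num
  have h := Complex.Gamma_mul_Gamma_eq_betaIntegral hu hv
  rw [show (1 / 2 + Complex.I * w : ℂ) = 1 - (1 / 2 - Complex.I * w) by ring,
    Complex.Gamma_mul_Gamma_one_sub,
    show (1 / 2 - Complex.I * w : ℂ) + (1 - (1 / 2 - Complex.I * w)) = 1 by ring,
    Complex.Gamma_one, one_mul, show (1 : ℂ) - (1 / 2 - Complex.I * w) = 1 / 2 + Complex.I * w by
      ring, Complex.betaIntegral, intervalIntegral.integral_of_le zero_le_one,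
    integral_Ioc_eq_integral_Ioo, ← image_sigmoid_two_pi_mul,
    integral_image_eq_integral_abs_deriv_smul MeasurableSet.univ
      (fun x _ ↦ (hasDerivAt_sigmoid_two_pi_mul x).hasDerivWithinAt)
      injective_sigmoid_two_pi_mul.injOn, setIntegral_univ] at h
  simp_rw [sigmoid_beta_integrand] at h
  rw [integral_const_mul, ← fourier_real_eq_integral_exp_smul,
    show (π : ℂ) * (1 / 2 - Complex.I * w) = π / 2 - (π * w) * Complex.I by ring,
    Complex.sin_pi_div_two_sub, Complex.cos_mul_I, div_eq_mul_one_div] at h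
  rw [← mul_left_cancel₀ hpi h]
  push_cast
  rfl

open FourierTransform in
lemma gaussian_sech_functional_equation {b : ℝ} (hb : 0 < b) :
    ∫ x : ℝ, exp (-π * b⁻¹ * x ^ 2) / cosh (π * x) =
      √b * ∫ x : ℝ, exp (-π * b * x ^ 2) / cosh (π * x) := by
  have hp := pi_pos
  have hg : Integrable (fun x : ℝ ↦ Complex.exp (-π * b * x ^ 2)) := by
    have := integrable_cexp_neg_mul_sq (b := π * b) (by
      rw [← Complex.ofReal_mul, Complex.ofReal_re]; positivity)
    simpa only [neg_mul] using this
  have h := VectorFourier.integral_fourierIntegral_smul_eq_flip (L := innerₗ ℝ)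
    continuous_fourierChar continuous_inner hg
    (integrable_one_div_cosh_pi_mul.ofReal (𝕜 := ℂ))
  rw [flip_innerₗ] at h
  change ∫ ξ : ℝ, (𝓕 (fun x : ℝ ↦ Complex.exp (-π * b * x ^ 2)) ξ) • ((1 / cosh (π * ξ) : ℝ) : ℂ)
    = ∫ x : ℝ, Complex.exp (-π * b * x ^ 2) •
      (𝓕 (fun x : ℝ ↦ ((1 / cosh (π * x) : ℝ) : ℂ)) x) at h
  rw [fourier_one_div_cosh_pi_mul, fourier_gaussian_pi (by simpa using hb)] at h
  have h1 : ∀ x : ℝ, (1 / (b : ℂ) ^ (1 / 2 : ℂ) * Complex.exp (-π / b * x ^ 2)) •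
      ((1 / cosh (π * x) : ℝ) : ℂ) =
      (((√b)⁻¹ * (exp (-π * b⁻¹ * x ^ 2) / cosh (π * x)) : ℝ) : ℂ) := by
    intro x
    rw [show (b : ℂ) ^ (1 / 2 : ℂ) = ((√b : ℝ) : ℂ) by
      rw [sqrt_eq_rpow, Complex.ofReal_cpow hb.le]; norm_num, smul_eq_mul]
    push_cast
    simp only [div_eq_mul_inv]
    ring
  have h2 : ∀ x : ℝ, Complex.exp (-π * b * x ^ 2) • ((1 / cosh (π * x) : ℝ) : ℂ) =
      ((exp (-π * b * x ^ 2) / cosh (π * x) : ℝ) : ℂ) := by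
    intro x
    rw [smul_eq_mul]
    push_cast
    ring
  simp_rw [h1, h2] at h
  rw [integral_complex_ofReal, integral_complex_ofReal, integral_const_mul] at h
  have h' := Complex.ofReal_injective h
  rw [← h', mul_inv_cancel_left₀ (by positivity)]

lemma integrable_mul_of_continuous_of_abs_le_one {g h : ℝ → ℝ} (hg : Integrable g)
    (hh : Continuous h) (hb : ∀ x, |h x| ≤ 1) : Integrable (fun x ↦ g x * h x) := by
  refine hg.norm.mono' (hg.aestronglyMeasurable.mul hh.aestronglyMeasurable) ?_
  filter_upwards with x
  rw [norm_mul]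
  exact mul_le_of_le_one_right (norm_nonneg _) (hb x)

lemma integrable_sq_mul_exp_neg_mul_sq {c : ℝ} (hc : 0 < c) :
    Integrable (fun x : ℝ ↦ x ^ 2 * exp (-c * x ^ 2)) := by
  simpa using integrable_rpow_mul_exp_neg_mul_sq hc (s := 2) (by norm_num)

lemma continuous_one_div_cosh_pi_mul : Continuous (fun x : ℝ ↦ 1 / cosh (π * x)) :=
  continuous_const.div (by fun_prop) fun x ↦ (cosh_pos _).ne'

lemma abs_one_div_cosh_le_one (y : ℝ) : |1 / cosh y| ≤ 1 := by
  rw [abs_of_pos (by have := cosh_pos y; positivity), div_le_one (cosh_pos _)]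
  exact one_le_cosh _

lemma continuous_sinh_div_cosh_sq_pi_mul :
    Continuous (fun x : ℝ ↦ sinh (π * x) / cosh (π * x) ^ 2) :=
  Continuous.div (by fun_prop) (by fun_prop) fun x ↦ (pow_pos (cosh_pos _) 2).ne'

lemma abs_sinh_div_cosh_sq_le_one (y : ℝ) : |sinh y / cosh y ^ 2| ≤ 1 := by
  rw [abs_div, abs_of_pos (pow_pos (cosh_pos y) 2), div_le_one (pow_pos (cosh_pos y) 2)]
  have h2 := cosh_sq y
  refine abs_le.mpr ⟨?_, ?_⟩ <;> nlinarith [sq_nonneg (sinh y - 1), sq_nonneg (sinh y + 1)]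

lemma integrable_exp_neg_pi_mul_sq {b : ℝ} (hb : 0 < b) :
    Integrable (fun x : ℝ ↦ exp (-π * b * x ^ 2)) := by
  simpa only [neg_mul] using integrable_exp_neg_mul_sq (mul_pos pi_pos hb)

lemma integrable_sq_mul_exp_neg_pi_mul_sq {b : ℝ} (hb : 0 < b) :
    Integrable (fun x : ℝ ↦ x ^ 2 * exp (-π * b * x ^ 2)) := by
  simpa only [neg_mul] using integrable_sq_mul_exp_neg_mul_sq (mul_pos pi_pos hb)

lemma integrable_gaussian_div_cosh {b : ℝ} (hb : 0 < b) :
    Integrable (fun x : ℝ ↦ exp (-π * b * x ^ 2) / cosh (π * x)) := by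
  simpa only [mul_one_div] using integrable_mul_of_continuous_of_abs_le_one
    (integrable_exp_neg_pi_mul_sq hb) continuous_one_div_cosh_pi_mul
    fun x ↦ abs_one_div_cosh_le_one _

lemma integrable_sq_mul_gaussian_div_cosh {b : ℝ} (hb : 0 < b) :
    Integrable (fun x : ℝ ↦ x ^ 2 * exp (-π * b * x ^ 2) / cosh (π * x)) := by
  simpa only [mul_one_div] using integrable_mul_of_continuous_of_abs_le_one
    (integrable_sq_mul_exp_neg_pi_mul_sq hb) continuous_one_div_cosh_pi_mul
    fun x ↦ abs_one_div_cosh_le_one _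

lemma integrable_mul_gaussian_mul_sinh_div_cosh_sq {b : ℝ} (hb : 0 < b) :
    Integrable (fun x : ℝ ↦ x * exp (-π * b * x ^ 2) * (sinh (π * x) / cosh (π * x) ^ 2)) := by
  refine integrable_mul_of_continuous_of_abs_le_one ?_ continuous_sinh_div_cosh_sq_pi_mul
    fun x ↦ abs_sinh_div_cosh_sq_le_one _
  simpa only [neg_mul] using integrable_mul_exp_neg_mul_sq (mul_pos pi_pos hb)

lemma hasDerivAt_integral_gaussian_div_cosh {b : ℝ} (hb : 0 < b) :
    HasDerivAt (fun b ↦ ∫ x : ℝ, exp (-π * b * x ^ 2) / cosh (π * x))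
      (-π * ∫ x : ℝ, x ^ 2 * exp (-π * b * x ^ 2) / cosh (π * x)) b := by
  have hp := pi_pos
  rw [← integral_const_mul]
  refine (hasDerivAt_integral_of_dominated_loc_of_deriv_le
    (F' := fun c x ↦ -π * (x ^ 2 * exp (-π * c * x ^ 2) / cosh (π * x)))
    (bound := fun x ↦ π * (x ^ 2 * exp (-π * (b / 2) * x ^ 2)))
    (Ioi_mem_nhds (half_lt_self hb)) ?_ (integrable_gaussian_div_cosh hb)
    ((integrable_sq_mul_gaussian_div_cosh hb).const_mul _).aestronglyMeasurable ?_
    ((integrable_sq_mul_exp_neg_pi_mul_sq (half_pos hb)).const_mul _) ?_).2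
  · filter_upwards [Ioi_mem_nhds hb] with c hc
    exact (integrable_gaussian_div_cosh hc).aestronglyMeasurable
  · filter_upwards with x c hc
    have hc : b / 2 < c := hc
    rw [norm_mul, norm_div, norm_mul, norm_neg, norm_of_nonneg hp.le, norm_of_nonneg (sq_nonneg x),
      norm_of_nonneg (exp_pos _).le, norm_of_nonneg (cosh_pos _).le]
    refine mul_le_mul_of_nonneg_left ?_ hp.le
    refine (div_le_self (by positivity) (one_le_cosh _)).trans ?_
    refine mul_le_mul_of_nonneg_left (exp_le_exp.mpr ?_) (sq_nonneg x)
    have := mul_le_mul_of_nonneg_left hc.le (mul_nonneg hp.le (sq_nonneg x))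
    linarith
  · filter_upwards with x c _
    have h : HasDerivAt (fun c : ℝ ↦ -π * c * x ^ 2) (-π * 1 * x ^ 2) c :=
      ((hasDerivAt_id c).const_mul (-π)).mul_const _
    convert! h.exp.div_const (cosh (π * x)) using 1
    ring

lemma integral_mul_gaussian_mul_sinh_div_cosh_sq {b : ℝ} (hb : 0 < b) :
    π * ∫ x : ℝ, x * exp (-π * b * x ^ 2) * (sinh (π * x) / cosh (π * x) ^ 2) =
      (∫ x : ℝ, exp (-π * b * x ^ 2) / cosh (π * x)) -
        2 * π * b * ∫ x : ℝ, x ^ 2 * exp (-π * b * x ^ 2) / cosh (π * x) := by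
  have hp := pi_pos
  have hu (x : ℝ) : HasDerivAt (fun x : ℝ ↦ x * exp (-π * b * x ^ 2))
      ((1 - 2 * π * b * x ^ 2) * exp (-π * b * x ^ 2)) x := by
    have h : HasDerivAt (fun x : ℝ ↦ -π * b * x ^ 2) (-π * b * (2 * x)) x := by
      simpa using (hasDerivAt_pow 2 x).const_mul (-π * b)
    convert! (hasDerivAt_id x).mul h.exp using 1
    simp only [id]
    ring
  have hv (x : ℝ) : HasDerivAt (fun x : ℝ ↦ 1 / cosh (π * x))
      (-π * (sinh (π * x) / cosh (π * x) ^ 2)) x := by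
    have h : HasDerivAt (fun x : ℝ ↦ cosh (π * x)) (sinh (π * x) * π) x := by
      simpa using ((hasDerivAt_id x).const_mul π).cosh
    simp only [one_div]
    convert! h.fun_inv (cosh_pos _).ne' using 1
    ring
  have hint := integrable_gaussian_div_cosh hb
  have hint2 := (integrable_sq_mul_gaussian_div_cosh hb).const_mul (2 * π * b)
  have e : (fun x : ℝ ↦ (1 - 2 * π * b * x ^ 2) * exp (-π * b * x ^ 2) * (1 / cosh (π * x))) =
      fun x ↦ exp (-π * b * x ^ 2) / cosh (π * x) -
        2 * π * b * (x ^ 2 * exp (-π * b * x ^ 2) / cosh (π * x)) := by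
    ext x; ring
  have e2 : (fun x : ℝ ↦ x * exp (-π * b * x ^ 2) * (-π * (sinh (π * x) / cosh (π * x) ^ 2))) =
      fun x ↦ -π * (x * exp (-π * b * x ^ 2) * (sinh (π * x) / cosh (π * x) ^ 2)) := by
    ext x; ring
  have hudv : Integrable
      (fun x : ℝ ↦ x * exp (-π * b * x ^ 2) * (-π * (sinh (π * x) / cosh (π * x) ^ 2))) := by
    rw [e2]
    exact (integrable_mul_gaussian_mul_sinh_div_cosh_sq hb).const_mul _
  have hduv : Integrable
      (fun x : ℝ ↦ (1 - 2 * π * b * x ^ 2) * exp (-π * b * x ^ 2) * (1 / cosh (π * x))) := by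
    rw [e]
    exact hint.sub hint2
  have huv : Integrable (fun x : ℝ ↦ x * exp (-π * b * x ^ 2) * (1 / cosh (π * x))) := by
    refine integrable_mul_of_continuous_of_abs_le_one ?_ continuous_one_div_cosh_pi_mul
      fun x ↦ abs_one_div_cosh_le_one _
    simpa only [neg_mul] using integrable_mul_exp_neg_mul_sq (mul_pos pi_pos hb)
  have h := integral_mul_deriv_eq_deriv_mul_of_integrable (fun x _ ↦ hu x) (fun x _ ↦ hv x)
    hudv hduv huv
  rw [e, e2, integral_sub hint hint2, integral_const_mul, integral_const_mul] at h
  linarith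

/-- The derivative of `gaussian_sech_functional_equation` at `b`. -/
lemma sq_mul_gaussian_sech_functional_equation {b : ℝ} (hb : 0 < b) :
    π * (b ^ 2)⁻¹ * ∫ x : ℝ, x ^ 2 * exp (-π * b⁻¹ * x ^ 2) / cosh (π * x) =
      1 / (2 * √b) * (∫ x : ℝ, exp (-π * b * x ^ 2) / cosh (π * x)) -
        √b * π * ∫ x : ℝ, x ^ 2 * exp (-π * b * x ^ 2) / cosh (π * x) := by
  have h1 := (hasDerivAt_integral_gaussian_div_cosh (inv_pos.mpr hb)).comp b
    (hasDerivAt_inv hb.ne')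
  have h2 := (hasDerivAt_sqrt hb.ne').mul (hasDerivAt_integral_gaussian_div_cosh hb)
  have h3 := h1.unique (h2.congr_of_eventuallyEq (by
    filter_upwards [Ioi_mem_nhds hb] with c hc
    exact gaussian_sech_functional_equation hc))
  linarith

lemma integral_Ioi_eq_half_integral_of_even {f : ℝ → ℝ} (hf : ∀ x, f (-x) = f x) :
    ∫ x in Set.Ioi (0 : ℝ), f x = (∫ x, f x) / 2 := by
  have : ∀ x, f |x| = f x := fun x ↦ by
    rcases abs_choice x with h | h <;> rw [h]
    exact hf x
  have h := integral_comp_abs (f := f)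
  simp_rw [this] at h
  linarith

theorem russell_integral_1 :
    ∫ x in Set.Ioi (0:ℝ),
      x * ((1 / π) * Real.exp (-x^2 / π^2) + (1 / Real.sqrt π) * Real.exp (-x^2)) *
        (Real.sinh x / (Real.cosh x)^2) =
    ∫ x in Set.Ioi (0:ℝ), Real.exp (-x^2) / Real.cosh (π * x) := by
  have hp := pi_pos
  have hp' : 0 < π⁻¹ := inv_pos.mpr hp
  rw [integral_Ioi_eq_half_integral_of_even (fun x ↦ by rw [neg_sq, sinh_neg, cosh_neg]; ring),
    integral_Ioi_eq_half_integral_of_even (fun x ↦ by rw [neg_sq, mul_neg, cosh_neg])]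
  congr 1
  have hcv := Measure.integral_comp_mul_left (fun x : ℝ ↦
    x * ((1 / π) * exp (-x^2 / π^2) + (1 / √π) * exp (-x^2)) * (sinh x / (cosh x)^2)) π
  rw [abs_of_pos hp', smul_eq_mul] at hcv
  have e (x : ℝ) : π * x * ((1 / π) * exp (-(π * x)^2 / π^2) + (1 / √π) * exp (-(π * x)^2)) *
      (sinh (π * x) / (cosh (π * x))^2) =
      x * exp (-π * π⁻¹ * x ^ 2) * (sinh (π * x) / cosh (π * x) ^ 2) +
      √π * (x * exp (-π * π * x ^ 2) * (sinh (π * x) / cosh (π * x) ^ 2)) := by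
    have e1 : -(π * x)^2 / π^2 = -π * π⁻¹ * x ^ 2 := by field_simp
    have e2 : -(π * x)^2 = -π * π * x ^ 2 := by ring
    have e3 : π * (1 / √π) = √π := by rw [mul_one_div, div_sqrt]
    rw [e1, e2]
    calc _ = (π * (1 / π)) * (x * exp (-π * π⁻¹ * x ^ 2) * (sinh (π * x) / cosh (π * x) ^ 2)) +
          (π * (1 / √π)) * (x * exp (-π * π * x ^ 2) * (sinh (π * x) / cosh (π * x) ^ 2)) := by ring
      _ = _ := by rw [e3, mul_one_div_cancel hp.ne', one_mul]
  simp_rw [e] at hcv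
  rw [integral_add (integrable_mul_gaussian_mul_sinh_div_cosh_sq hp')
    ((integrable_mul_gaussian_mul_sinh_div_cosh_sq hp).const_mul _), integral_const_mul] at hcv
  have i1 := integral_mul_gaussian_mul_sinh_div_cosh_sq hp'
  have i2 := integral_mul_gaussian_mul_sinh_div_cosh_sq hp
  have fe := sq_mul_gaussian_sech_functional_equation hp
  have er (x : ℝ) : exp (-x ^ 2) = exp (-π * π⁻¹ * x ^ 2) := by
    congr 1; field_simp
  rw [(inv_mul_eq_iff_eq_mul₀ hp.ne').mp hcv.symm]
  simp_rw [er]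
  rw [mul_add, i1, mul_left_comm, i2]
  have hs : √π * √π = π := mul_self_sqrt hp.le
  generalize (∫ x : ℝ, x ^ 2 * exp (-π * π⁻¹ * x ^ 2) / cosh (π * x)) = A at *
  generalize (∫ x : ℝ, x ^ 2 * exp (-π * π * x ^ 2) / cosh (π * x)) = B at *
  generalize (∫ x : ℝ, exp (-π * π * x ^ 2) / cosh (π * x)) = C at *
  have fe' : 2 * A = √π * C - 2 * π ^ 2 * √π * B := by
    have h1 : 2 * π * (π * (π ^ 2)⁻¹ * A) = 2 * A := by field_simp
    have h2 : 2 * π * (1 / (2 * √π) * C) = √π * C := by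
      field_simp
      rw [sq, hs]
    rw [← h1, fe, mul_sub, h2]
    ring
  have h3 : 2 * π * π⁻¹ * A = 2 * A := by field_simp
  rw [h3, fe']
  ring
end

section
/- ∫₀^∞ x² e^{-x²}/cosh(√π x) dx = (1/4) ∫₀^∞ e^{-x²}/cosh(√π x) dx. -/
open Real MeasureTheory

open scoped FourierTransform

theorem one_add_sq_div_two_le_cosh (x : ℝ) : 1 + x ^ 2 / 2 ≤ Real.cosh x := by
  have h : (x / 2) ^ 2 ≤ Real.sinh (x / 2) ^ 2 := by
    rw [sq_le_sq, abs_sinh]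
    exact self_le_sinh_iff.2 (abs_nonneg _)
  have h' := Real.cosh_two_mul (x / 2)
  rw [mul_div_cancel₀ x two_ne_zero, Real.cosh_sq] at h'
  linarith

theorem integrable_inv_cosh_pi_mul :
    Integrable fun x : ℝ => (Real.cosh (π * x))⁻¹ := by
  refine integrable_inv_one_add_sq.mono' ?_ (.of_forall fun x => ?_)
  · exact ((by fun_prop : Continuous fun x : ℝ => Real.cosh (π * x)).inv₀
      fun x => (Real.cosh_pos _).ne').aestronglyMeasurable
  · rw [Real.norm_of_nonneg (inv_nonneg.2 (Real.cosh_pos _).le)]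
    gcongr
    have h := one_add_sq_div_two_le_cosh (π * x)
    nlinarith [Real.pi_gt_three, sq_nonneg x,
      mul_nonneg (sq_nonneg x) (sub_nonneg.2 pi_gt_three.le)]

theorem sigmoid_smul_beta_integrand (u : ℂ) (t : ℝ) :
    |2 * π * (sigmoid (2 * π * t) * (1 - sigmoid (2 * π * t)))| •
      ((sigmoid (2 * π * t) : ℂ) ^ (u - 1) * (1 - (sigmoid (2 * π * t) : ℂ)) ^ ((1 - u) - 1)) =
    π * (Complex.exp (2 * π * t * (u - 1 / 2)) * ((Real.cosh (π * t))⁻¹ : ℝ)) := by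
  have hs := sigmoid_pos (2 * π * t)
  have h1 : 1 - sigmoid (2 * π * t) = sigmoid (2 * π * t) * Real.exp (-(2 * π * t)) := by
    rw [← sigmoid_neg, sigmoid_mul_rexp_neg]
  have hcosh : sigmoid (2 * π * t) * Real.exp (-(π * t)) = (2 * Real.cosh (π * t))⁻¹ := by
    rw [sigmoid_def, Real.cosh_eq, inv_mul_eq_div, div_eq_iff (by positivity),
      mul_div_cancel₀ _ two_ne_zero, inv_mul_eq_div, eq_div_iff (by positivity), mul_add,
      ← Real.exp_add, ← Real.exp_add]
    ring_nf
    simp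
  have hc : (1 - (sigmoid (2 * π * t) : ℂ)) =
      (sigmoid (2 * π * t) : ℂ) * (Real.exp (-(2 * π * t)) : ℝ) := by
    exact_mod_cast h1
  have hs0 : (sigmoid (2 * π * t) : ℂ) ≠ 0 := by exact_mod_cast hs.ne'
  have hexp : ((Real.exp (-(2 * π * t)) : ℝ) : ℂ) ^ (-u) = Complex.exp (2 * π * t * u) := by
    rw [Complex.cpow_def_of_ne_zero (by exact_mod_cast (Real.exp_pos _).ne'),
      ← Complex.ofReal_log (Real.exp_pos _).le, Real.log_exp]
    congr 1
    push_cast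
    ring
  have hsplit : Complex.exp (2 * π * t * (u - 1 / 2)) =
      Complex.exp (2 * π * t * u) * (Real.exp (-(π * t)) : ℝ) := by
    rw [Complex.ofReal_exp, ← Complex.exp_add]
    congr 1
    push_cast
    ring
  have hsq : Real.exp (-(2 * π * t)) = Real.exp (-(π * t)) * Real.exp (-(π * t)) := by
    rw [← Real.exp_add]
    ring_nf
  have hinv : (Real.cosh (π * t))⁻¹ = 2 * (sigmoid (2 * π * t) * Real.exp (-(π * t))) := by
    rw [hcosh, mul_inv, mul_inv_cancel_left₀ two_ne_zero]
  have hpow : (sigmoid (2 * π * t) : ℂ) ^ (u - 1) * (sigmoid (2 * π * t) : ℂ) ^ (-u) =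
      (sigmoid (2 * π * t) : ℂ)⁻¹ := by
    rw [← Complex.cpow_add _ _ hs0, ← Complex.cpow_neg_one]
    ring_nf
  rw [show 1 - u - 1 = -u by ring, hc, Complex.mul_cpow_ofReal_nonneg hs.le (Real.exp_pos _).le,
    hexp, ← mul_assoc (_ ^ (u - 1)), hpow, h1, abs_of_pos (by positivity), hsplit, hinv, hsq,
    Complex.real_smul]
  push_cast
  field_simp

theorem integral_exp_mul_inv_cosh_pi_mul {u : ℂ} (h0 : 0 < u.re) (h1 : u.re < 1) :
    ∫ t : ℝ, Complex.exp (2 * π * t * (u - 1 / 2)) * ((Real.cosh (π * t))⁻¹ : ℝ) =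
      1 / Complex.sin (π * u) := by
  have hd (t : ℝ) : HasDerivAt (fun t => sigmoid (2 * π * t))
      (2 * π * (sigmoid (2 * π * t) * (1 - sigmoid (2 * π * t)))) t := by
    simpa [mul_comm, Function.comp_def] using (hasDerivAt_sigmoid (2 * π * t)).comp t
      ((hasDerivAt_id t).const_mul (2 * π))
  have hinj : Function.Injective fun t : ℝ => sigmoid (2 * π * t) :=
    sigmoid_injective.comp (mul_right_injective₀ (by positivity))
  have hrange : (fun t : ℝ => sigmoid (2 * π * t)) '' Set.univ = Set.Ioo 0 1 := by
    rw [Set.image_univ, ← range_sigmoid]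
    exact (mul_left_surjective₀ (by positivity : 2 * π ≠ 0)).range_comp sigmoid
  have hbeta : Complex.betaIntegral u (1 - u) = π / Complex.sin (π * u) := by
    have h := Complex.Gamma_mul_Gamma_eq_betaIntegral h0 (t := 1 - u) (by simpa using h1)
    rw [Complex.Gamma_mul_Gamma_one_sub, add_sub_cancel, Complex.Gamma_one, one_mul] at h
    exact h.symm
  rw [Complex.betaIntegral, intervalIntegral.integral_of_le zero_le_one,
    integral_Ioc_eq_integral_Ioo, ← hrange,
    integral_image_eq_integral_abs_deriv_smul MeasurableSet.univ
      (fun t _ => (hd t).hasDerivWithinAt) hinj.injOn, setIntegral_univ] at hbeta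
  simp_rw [sigmoid_smul_beta_integrand, integral_const_mul] at hbeta
  have hpi : (π : ℂ) ≠ 0 := by simp [pi_ne_zero]
  apply mul_left_cancel₀ hpi
  rw [hbeta, mul_one_div]

theorem fourier_inv_cosh_pi_mul :
    𝓕 (fun x : ℝ => (((Real.cosh (π * x))⁻¹ : ℝ) : ℂ)) =
      fun x : ℝ => (((Real.cosh (π * x))⁻¹ : ℝ) : ℂ) := by
  ext ξ
  have h := integral_exp_mul_inv_cosh_pi_mul (u := 1 / 2 - ξ * Complex.I)
    (by simp) (by norm_num)
  rw [Real.fourier_real_eq_integral_exp_smul]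
  convert h using 1
  · congr with t
    rw [smul_eq_mul]
    congr 2
    push_cast
    ring
  · rw [mul_sub, mul_one_div, Complex.sin_pi_div_two_sub, ← mul_assoc, Complex.cos_mul_I]
    simp

theorem fourier_gaussian_pi_one :
    𝓕 (fun x : ℝ => Complex.exp (-π * x ^ 2)) = fun x : ℝ => Complex.exp (-π * x ^ 2) := by
  simpa using fourier_gaussian_pi (b := 1) (by simp)

theorem integrable_pow_mul_cexp_neg_pi_mul_sq (n : ℕ) :
    Integrable fun x : ℝ => (x : ℂ) ^ n * Complex.exp (-π * x ^ 2) := by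
  have h := (integrable_rpow_mul_exp_neg_mul_sq pi_pos (s := n)
    (by linarith [n.cast_nonneg (α := ℝ)])).ofReal (𝕜 := ℂ)
  simpa using h

theorem fourier_sq_mul_gaussian_pi :
    𝓕 (fun x : ℝ => (x : ℂ) ^ 2 * Complex.exp (-π * x ^ 2)) =
      fun x : ℝ => (1 / (2 * π) - (x : ℂ) ^ 2) * Complex.exp (-π * x ^ 2) := by
  have hG (x : ℝ) : HasDerivAt (fun x : ℝ => Complex.exp (-π * x ^ 2))
      (-2 * π * x * Complex.exp (-π * x ^ 2)) x := by
    convert! ((((hasDerivAt_id x).ofReal_comp).pow 2).const_mul (-π : ℂ)).cexp using 1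
    simp
    ring
  have hG' (x : ℝ) : HasDerivAt (fun x : ℝ => -2 * π * x * Complex.exp (-π * x ^ 2))
      ((4 * π ^ 2 * x ^ 2 - 2 * π) * Complex.exp (-π * x ^ 2)) x := by
    convert! (((hasDerivAt_id x).ofReal_comp).const_mul (-2 * π : ℂ)).mul (hG x) using 1
    simp
    ring
  have hi := integrable_pow_mul_cexp_neg_pi_mul_sq
  have h1 := deriv_fourier (f := fun x : ℝ => Complex.exp (-π * x ^ 2))
    (by simpa using hi 0) (by simpa using hi 1)
  rw [fourier_gaussian_pi_one, funext fun x => (hG x).deriv] at h1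
  have h2 := deriv_fourier
    (f := fun x : ℝ => (-2 * π * Complex.I * x) • Complex.exp (-π * x ^ 2))
    (by simpa [mul_assoc] using (hi 1).const_mul (-2 * π * Complex.I))
    (((hi 2).const_mul (-2 * π * Complex.I)).congr (.of_forall fun x => by
      simp only [smul_eq_mul, Complex.real_smul]
      ring))
  rw [← h1, funext fun x => (hG' x).deriv] at h2
  have hpi : (π : ℂ) ≠ 0 := by simp [pi_ne_zero]
  have h3 : (fun x : ℝ => (x : ℂ) ^ 2 * Complex.exp (-π * x ^ 2)) =
      (-(4 * π ^ 2 : ℂ)⁻¹) • fun x : ℝ =>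
        (-2 * π * Complex.I * x) • (-2 * π * Complex.I * x) • Complex.exp (-π * x ^ 2) := by
    ext x
    simp only [Pi.smul_apply, smul_eq_mul]
    field_simp
    ring_nf
    simp [Complex.I_sq]
  have h4 (f : ℝ → ℂ) (c : ℂ) : 𝓕 (c • f) = c • 𝓕 f :=
    VectorFourier.fourierIntegral_const_smul _ _ _ _ _
  rw [h3, h4, ← h2]
  ext x
  simp only [Pi.smul_apply, smul_eq_mul]
  field_simp
  ring

theorem integral_sq_mul_exp_neg_pi_mul_sq_div_cosh :
    4 * π * ∫ x : ℝ, x ^ 2 * (Real.exp (-π * x ^ 2) * (Real.cosh (π * x))⁻¹) =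
      ∫ x : ℝ, Real.exp (-π * x ^ 2) * (Real.cosh (π * x))⁻¹ := by
  have hi := integrable_pow_mul_cexp_neg_pi_mul_sq
  have h : ∫ x : ℝ, 𝓕 (fun x : ℝ => (x : ℂ) ^ 2 * Complex.exp (-π * x ^ 2)) x •
        (((Real.cosh (π * x))⁻¹ : ℝ) : ℂ) =
      ∫ x : ℝ, ((x : ℂ) ^ 2 * Complex.exp (-π * x ^ 2)) •
        𝓕 (fun x : ℝ => (((Real.cosh (π * x))⁻¹ : ℝ) : ℂ)) x := by
    simpa using! VectorFourier.integral_fourierIntegral_smul_eq_flip (L := innerₗ ℝ)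
      Real.continuous_fourierChar continuous_inner (hi 2)
      (integrable_inv_cosh_pi_mul.ofReal (𝕜 := ℂ))
  rw [fourier_sq_mul_gaussian_pi, fourier_inv_cosh_pi_mul] at h
  have h' : ∫ x : ℝ, (1 / (2 * π) - x ^ 2) * (Real.exp (-π * x ^ 2) * (Real.cosh (π * x))⁻¹) =
      ∫ x : ℝ, x ^ 2 * (Real.exp (-π * x ^ 2) * (Real.cosh (π * x))⁻¹) := by
    apply Complex.ofReal_injective
    rw [← integral_complex_ofReal, ← integral_complex_ofReal]
    simpa [mul_assoc] using h
  have hpow_int (n : ℕ) : Integrable fun x : ℝ =>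
      x ^ n * (Real.exp (-π * x ^ 2) * (Real.cosh (π * x))⁻¹) := by
    have hg : Integrable fun x : ℝ => x ^ n * Real.exp (-π * x ^ 2) := by
      simpa using integrable_rpow_mul_exp_neg_mul_sq pi_pos (s := n)
        (by linarith [n.cast_nonneg (α := ℝ)])
    refine (hg.mul_bdd (c := 1) integrable_inv_cosh_pi_mul.aestronglyMeasurable
      (.of_forall fun x => ?_)).congr (.of_forall fun x => mul_assoc _ _ _)
    rw [Real.norm_of_nonneg (inv_nonneg.2 (Real.cosh_pos _).le)]
    exact inv_le_one_of_one_le₀ (Real.one_le_cosh _)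
  simp_rw [sub_mul] at h'
  have hgauss_int : Integrable fun x : ℝ => Real.exp (-π * x ^ 2) * (Real.cosh (π * x))⁻¹ := by
    simpa using hpow_int 0
  rw [integral_sub (hgauss_int.const_mul (1 / (2 * π))) (hpow_int 2),
    integral_const_mul] at h'
  have hpi : 2 * π * (1 / (2 * π)) = 1 := by field_simp
  linear_combination (-2 * π) * h' +
    (∫ x : ℝ, Real.exp (-π * x ^ 2) * (Real.cosh (π * x))⁻¹) * hpi

theorem russell_integral_6 :
    ∫ x in Set.Ioi (0:ℝ), x^2 * Real.exp (-x^2) / Real.cosh (Real.sqrt π * x) =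
    (1/4) * ∫ x in Set.Ioi (0:ℝ), Real.exp (-x^2) / Real.cosh (Real.sqrt π * x) := by
  have hpos : 0 < √π := sqrt_pos.2 pi_pos
  have hsq : √π ^ 2 = π := sq_sqrt pi_pos.le
  have hmul (x : ℝ) : √π * (√π * x) = π * x := by rw [← mul_assoc, ← sq, hsq]
  have h := integral_sq_mul_exp_neg_pi_mul_sq_div_cosh
  have h1 := integral_comp_abs
    (f := fun x : ℝ => x ^ 2 * (Real.exp (-π * x ^ 2) * (Real.cosh (π * x))⁻¹))
  have h2 := integral_comp_abs
    (f := fun x : ℝ => Real.exp (-π * x ^ 2) * (Real.cosh (π * x))⁻¹)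
  have habs (x : ℝ) : Real.cosh (π * |x|) = Real.cosh (π * x) := by
    rw [← Real.cosh_abs (π * x), abs_mul, abs_of_pos pi_pos]
  simp only [sq_abs, habs] at h1 h2
  have e1 := integral_comp_mul_left_Ioi
    (fun x : ℝ => x ^ 2 * Real.exp (-x ^ 2) / Real.cosh (√π * x)) 0 hpos
  have e2 := integral_comp_mul_left_Ioi
    (fun x : ℝ => Real.exp (-x ^ 2) / Real.cosh (√π * x)) 0 hpos
  simp only [hmul, mul_pow, hsq, mul_zero, smul_eq_mul, div_eq_mul_inv, mul_assoc, neg_mul,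
    integral_const_mul] at e1 e2 h1 h2 h ⊢
  rw [h1, h2] at h
  rw [eq_inv_mul_iff_mul_eq₀ hpos.ne'] at e1 e2
  rw [← e1, ← e2]
  linear_combination (√π / 8) * h
end

section
/- ∫₀^∞ x (3 − 4πx²) e^{-πx(x+1)}/sinh(πx) dx = 1/(2π). -/
open Real MeasureTheory

open Filter Topology Set in
lemma tendsto_pow_mul_gaussian (n : ℕ) :
    Tendsto (fun x : ℝ => x ^ n * Real.exp (-π * x ^ 2)) atTop (𝓝 0) := by
  have h := (rpow_mul_exp_neg_mul_sq_isLittleO_exp_neg pi_pos n).tendsto_zero_of_tendsto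
    (tendsto_exp_atBot.comp (tendsto_id.const_mul_atTop_of_neg (by norm_num : -(1 / 2 : ℝ) < 0)))
  simpa using h

lemma integrableOn_pow_mul_gaussian (n : ℕ) :
    IntegrableOn (fun x : ℝ => x ^ n * Real.exp (-π * x ^ 2)) (Set.Ioi 0) := by
  simpa using integrableOn_rpow_mul_exp_neg_mul_sq pi_pos
    (show (-1 : ℝ) < n from lt_of_lt_of_le (by norm_num) n.cast_nonneg)

lemma hasDerivAt_gaussian (x : ℝ) :
    HasDerivAt (fun x : ℝ => Real.exp (-π * x ^ 2)) (-(2 * π * x) * Real.exp (-π * x ^ 2)) x := by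
  convert! (((hasDerivAt_id x).pow 2).const_mul (-π)).exp using 1
  simp
  ring

/-- A multiple of the third Hermite function, an eigenfunction of the sine transform. -/
noncomputable def hermiteThree (x : ℝ) : ℝ := x * (3 - 4 * π * x ^ 2) * Real.exp (-π * x ^ 2)

lemma continuous_hermiteThree : Continuous hermiteThree := by
  unfold hermiteThree
  fun_prop

lemma integrableOn_hermiteThree : IntegrableOn hermiteThree (Set.Ioi 0) := by
  refine (((integrableOn_pow_mul_gaussian 1).const_mul 3).sub
    ((integrableOn_pow_mul_gaussian 3).const_mul (4 * π))).congr (ae_of_all _ fun x => ?_)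
  simp only [Pi.sub_apply, hermiteThree]
  ring

lemma integrableOn_mul_hermiteThree :
    IntegrableOn (fun x => x * hermiteThree x) (Set.Ioi 0) := by
  refine (((integrableOn_pow_mul_gaussian 2).const_mul 3).sub
    ((integrableOn_pow_mul_gaussian 4).const_mul (4 * π))).congr (ae_of_all _ fun x => ?_)
  simp only [Pi.sub_apply, hermiteThree]
  ring

lemma integrableOn_quadratic_mul_gaussian :
    IntegrableOn (fun x => (3 - 4 * π * x ^ 2) * Real.exp (-π * x ^ 2)) (Set.Ioi 0) := by
  refine (((integrableOn_pow_mul_gaussian 0).const_mul 3).sub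
    ((integrableOn_pow_mul_gaussian 2).const_mul (4 * π))).congr (ae_of_all _ fun x => ?_)
  simp only [Pi.sub_apply]
  ring

lemma integral_hermiteThree : ∫ x in Set.Ioi 0, hermiteThree x = -(1 / (2 * π)) := by
  have h := integral_Ioi_of_hasDerivAt_of_tendsto' (a := 0) (m := 0) (f' := hermiteThree)
    (f := fun x => (2 * x ^ 2 + 1 / (2 * π)) * Real.exp (-π * x ^ 2)) (fun x _ => ?_)
    integrableOn_hermiteThree ?_
  · simpa using h
  · convert! ((((hasDerivAt_id x).pow 2).const_mul 2).add_const (1 / (2 * π))).mul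
      (hasDerivAt_gaussian x) using 1
    simp [hermiteThree]
    field_simp
    ring
  · convert! ((tendsto_pow_mul_gaussian 2).const_mul 2).add
      ((tendsto_pow_mul_gaussian 0).const_mul (1 / (2 * π))) using 2
    · ring
    · simp

lemma integral_quadratic_mul_gaussian :
    ∫ x in Set.Ioi 0, (3 - 4 * π * x ^ 2) * Real.exp (-π * x ^ 2) = 1 / 2 := by
  have hg : IntegrableOn (fun x : ℝ => Real.exp (-π * x ^ 2)) (Set.Ioi 0) := by
    simpa using integrableOn_pow_mul_gaussian 0
  have h := integral_Ioi_of_hasDerivAt_of_tendsto' (a := 0) (m := 0)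
    (f' := fun x => (3 - 4 * π * x ^ 2) * Real.exp (-π * x ^ 2) - Real.exp (-π * x ^ 2))
    (f := fun x => 2 * (x ^ 1 * Real.exp (-π * x ^ 2))) (fun x _ => ?_)
    (integrableOn_quadratic_mul_gaussian.sub hg) ?_
  · rw [integral_sub integrableOn_quadratic_mul_gaussian hg, integral_gaussian_Ioi] at h
    simp [pi_ne_zero] at h
    simp only [neg_mul]
    linarith
  · convert! (((hasDerivAt_id x).pow 1).mul (hasDerivAt_gaussian x)).const_mul 2 using 1
    simp
    ring
  · simpa using (tendsto_pow_mul_gaussian 1).const_mul 2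

/-- The cosine transform of the Gaussian. -/
lemma integral_gaussian_mul_cos (y : ℝ) :
    ∫ x in Set.Ioi 0, Real.exp (-π * x ^ 2) * Real.cos (2 * π * x * y) =
      Real.exp (-π * y ^ 2) / 2 := by
  have h := fourierIntegral_gaussian (b := π) (by simpa using pi_pos) ((2 * π * y : ℝ) : ℂ)
  have hint : Integrable (fun x : ℝ => Complex.exp (Complex.I * ((2 * π * y : ℝ) : ℂ) * x) *
      Complex.exp (-π * x ^ 2)) := by
    refine (integrable_exp_neg_mul_sq pi_pos).mono' (by fun_prop) (ae_of_all _ fun x => ?_)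
    rw [norm_mul, Complex.norm_exp, Complex.norm_exp]
    norm_cast
    simp
  have h2 := congrArg Complex.re h
  rw [← Complex.reCLM_apply, ← ContinuousLinearMap.integral_comp_comm _ hint] at h2
  have h3 : ∀ x : ℝ, Complex.reCLM (Complex.exp (Complex.I * ((2 * π * y : ℝ) : ℂ) * x) *
      Complex.exp (-π * x ^ 2)) = Real.exp (-π * |x| ^ 2) * Real.cos (2 * π * |x| * y) := by
    intro x
    have e1 : Complex.exp (-π * x ^ 2) = (Real.exp (-π * x ^ 2) : ℝ) := by push_cast; rfl
    have e2 : Real.cos (2 * π * |x| * y) = Real.cos (2 * π * y * x) := by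
      rcases abs_cases x with ⟨hx, _⟩ | ⟨hx, _⟩ <;> rw [hx]
      · ring_nf
      · rw [← Real.cos_neg]; ring_nf
    have e3 : Complex.I * ((2 * π * y : ℝ) : ℂ) * x = ((2 * π * y * x : ℝ) : ℂ) * Complex.I := by
      push_cast; ring
    rw [e1, e2, e3, sq_abs, Complex.reCLM_apply, Complex.re_mul_ofReal,
      Complex.exp_ofReal_mul_I_re, mul_comm]
  simp_rw [h3] at h2
  rw [integral_comp_abs (f := fun x => Real.exp (-π * x ^ 2) * Real.cos (2 * π * x * y))] at h2
  have e4 : -((2 * π * y : ℝ) : ℂ) ^ 2 / (4 * π) = ((-π * y ^ 2 : ℝ) : ℂ) := by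
    have : (π : ℂ) ≠ 0 := by exact_mod_cast pi_ne_zero
    push_cast
    field_simp
    ring
  rw [div_self (by exact_mod_cast pi_ne_zero), Complex.one_cpow, one_mul, e4,
    Complex.exp_ofReal_re] at h2
  linarith

/-- The third Hermite function is an eigenfunction of the sine transform. -/
lemma integral_hermiteThree_mul_sin (y : ℝ) :
    ∫ x in Set.Ioi 0, hermiteThree x * Real.sin (2 * π * x * y) = -(hermiteThree y / 2) := by
  have hs : IntegrableOn (fun x => hermiteThree x * Real.sin (2 * π * x * y)) (Set.Ioi 0) :=
    Integrable.mul_bdd (c := 1) integrableOn_hermiteThree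
      (by fun_prop) (ae_of_all _ fun x => by simpa using Real.abs_sin_le_one _)
  have hc : IntegrableOn (fun x => Real.exp (-π * x ^ 2) * Real.cos (2 * π * x * y))
      (Set.Ioi 0) :=
    Integrable.mul_bdd (c := 1) (by simpa [IntegrableOn] using integrableOn_pow_mul_gaussian 0)
      (by fun_prop) (ae_of_all _ fun x => by simpa using Real.abs_cos_le_one _)
  have h := integral_Ioi_of_hasDerivAt_of_tendsto' (a := 0) (m := 0)
    (f' := fun x => hermiteThree x * Real.sin (2 * π * x * y) -
      (4 * π * y ^ 3 - 3 * y) * (Real.exp (-π * x ^ 2) * Real.cos (2 * π * x * y)))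
    (f := fun x => Real.exp (-π * x ^ 2) * ((2 * x ^ 2 - (4 * π * y ^ 2 - 1) / (2 * π)) *
      Real.sin (2 * π * x * y) + 2 * y * x * Real.cos (2 * π * x * y))) (fun x _ => ?_)
    (hs.sub (hc.const_mul _)) ?_
  · rw [integral_sub hs (hc.const_mul _), integral_const_mul, integral_gaussian_mul_cos] at h
    simp at h
    rw [hermiteThree, neg_mul]
    linarith
  · have hl : HasDerivAt (fun x : ℝ => 2 * π * x * y) (2 * π * y) x := by
      simpa using ((hasDerivAt_id x).const_mul (2 * π)).mul_const y
    convert! (hasDerivAt_gaussian x).mul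
      ((((((hasDerivAt_id x).pow 2).const_mul 2).sub_const ((4 * π * y ^ 2 - 1) / (2 * π))).mul
        hl.sin).add (((hasDerivAt_id x).const_mul (2 * y)).mul hl.cos)) using 1
    simp [hermiteThree]
    field_simp
    ring
  · have h0 : ∀ (n : ℕ) (u : ℝ → ℝ), (∀ x, |u x| ≤ 1) →
        Filter.Tendsto (fun x => x ^ n * Real.exp (-π * x ^ 2) * u x) Filter.atTop (nhds 0) := by
      intro n u hu
      exact (tendsto_pow_mul_gaussian n).zero_mul_isBoundedUnder_le
        (Filter.isBoundedUnder_of ⟨1, by simpa using hu⟩)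
    have hsin := fun x => Real.abs_sin_le_one (2 * π * x * y)
    have hcos := fun x => Real.abs_cos_le_one (2 * π * x * y)
    convert! (((h0 2 _ hsin).const_mul 2).sub
      ((h0 0 _ hsin).const_mul ((4 * π * y ^ 2 - 1) / (2 * π)))).add
      ((h0 1 _ hcos).const_mul (2 * y)) using 2
    · ring
    · simp

/-- The partial fraction expansion of the hyperbolic cotangent. -/
lemma hasSum_coth {x : ℝ} (hx : 0 < x) :
    HasSum (fun n : ℕ => 2 * x / (x ^ 2 + (n + 1) ^ 2))
      (π * (Real.cosh (π * x) / Real.sinh (π * x)) - 1 / x) := by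
  have hz : (x * Complex.I : ℂ) ∈ Complex.integerComplement := by
    rintro ⟨n, hn⟩
    have := congrArg Complex.im hn
    simp at this
    exact hx.ne this
  have h := (summable_cotTerm hz).hasSum
  have hcot : ∑' n : ℕ, cotTerm (x * Complex.I) n =
      π * Complex.cot (π * (x * Complex.I)) - 1 / (x * Complex.I) := (cot_series_rep' hz).symm
  rw [hcot] at h
  have h2 := Complex.hasSum_re (h.mul_left Complex.I)
  have hx0 : (x : ℂ) ≠ 0 := by exact_mod_cast hx.ne'
  have hI := Complex.I_sq
  convert! h2 using 1
  · ext n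
    have e : Complex.I * cotTerm (x * Complex.I) n =
        ((2 * x / (x ^ 2 + (n + 1) ^ 2) : ℝ) : ℂ) := by
      have h1 : (x * Complex.I : ℂ) - (n + 1) ≠ 0 := by
        intro h; have := congrArg Complex.im h; simp at this; exact hx.ne' this
      have h2 : (x * Complex.I : ℂ) + (n + 1) ≠ 0 := by
        intro h; have := congrArg Complex.im h; simp at this; exact hx.ne' this
      have h3 : (x : ℂ) ^ 2 + (n + 1) ^ 2 ≠ 0 := by
        have : x ^ 2 + ((n : ℝ) + 1) ^ 2 ≠ 0 := by positivity
        exact_mod_cast this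
      push_cast
      rw [cotTerm, div_add_div _ _ h1 h2, ← mul_div_assoc, div_eq_div_iff (mul_ne_zero h1 h2) h3]
      linear_combination (2 * (x : ℂ) * (x ^ 2 + (n + 1) ^ 2) - 2 * x ^ 3) * hI
    rw [e, Complex.ofReal_re]
  · have e : Complex.I * (π * Complex.cot (π * (x * Complex.I)) - 1 / (x * Complex.I)) =
        ((π * (Real.cosh (π * x) / Real.sinh (π * x)) - 1 / x : ℝ) : ℂ) := by
      have hs : Complex.sinh (π * x) ≠ 0 := by
        have : Real.sinh (π * x) ≠ 0 := (Real.sinh_pos_iff.2 (by positivity)).ne'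
        exact_mod_cast this
      rw [← mul_assoc, Complex.cot, Complex.cos_mul_I, Complex.sin_mul_I]
      push_cast
      field_simp
    rw [e, Complex.ofReal_re]

lemma integral_sin_mul_exp_neg (a : ℝ) {b : ℝ} (hb : 0 < b) :
    ∫ y in Set.Ioi 0, Real.sin (a * y) * Real.exp (-b * y) = a / (a ^ 2 + b ^ 2) := by
  have hre : (-b + a * Complex.I : ℂ).re < 0 := by simpa using hb
  have h := congrArg Complex.im (integral_exp_mul_complex_Ioi hre 0)
  rw [← Complex.imCLM_apply, ← ContinuousLinearMap.integral_comp_comm _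
    (integrableOn_exp_mul_complex_Ioi hre 0)] at h
  convert! h using 1
  · refine integral_congr_ae (ae_of_all _ fun y => ?_)
    simp [Complex.exp_im]
    ring
  · simp [Complex.normSq_apply, Complex.div_im]
    ring

lemma integrableOn_mul_exp_neg {b : ℝ} (hb : 0 < b) :
    IntegrableOn (fun y => y * Real.exp (-b * y)) (Set.Ioi 0) := by
  simpa using integrableOn_rpow_mul_exp_neg_mul_rpow (s := 1) (p := 1) (by norm_num) one_pos hb

lemma integral_mul_exp_neg {b : ℝ} (hb : 0 < b) :
    ∫ y in Set.Ioi 0, y * Real.exp (-b * y) = 1 / b ^ 2 := by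
  have h := integral_rpow_mul_exp_neg_mul_Ioi (a := 2) two_pos hb
  norm_num at h
  simpa using h

/-- The weight `1 / (exp (2 * π * y) - 1)`. -/
noncomputable def planckWeight (y : ℝ) : ℝ := Real.exp (-(π * y)) / (2 * Real.sinh (π * y))

lemma planckWeight_nonneg {y : ℝ} (hy : 0 < y) : 0 ≤ planckWeight y := by
  have := Real.sinh_pos_iff.2 (mul_pos pi_pos hy)
  unfold planckWeight
  positivity

lemma mul_planckWeight_le {y : ℝ} (hy : 0 < y) :
    2 * π * y * planckWeight y ≤ Real.exp (-π * y) := by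
  have hs := Real.sinh_pos_iff.2 (mul_pos pi_pos hy)
  have hle := Real.self_le_sinh_iff.2 (mul_pos pi_pos hy).le
  rw [planckWeight, ← mul_div_assoc, div_le_iff₀ (by positivity), neg_mul]
  nlinarith [Real.exp_pos (-(π * y))]

lemma hasSum_planckWeight {y : ℝ} (hy : 0 < y) :
    HasSum (fun n : ℕ => Real.exp (-(2 * π * (n + 1)) * y)) (planckWeight y) := by
  have hpy : 0 < π * y := mul_pos pi_pos hy
  have h1 : Real.exp (-(2 * π * y)) < 1 := by
    rw [Real.exp_lt_one_iff]; nlinarith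
  convert! (hasSum_geometric_of_lt_one (Real.exp_pos _).le h1).mul_left
    (Real.exp (-(2 * π * y))) using 1
  · ext n
    rw [← Real.exp_nat_mul, ← Real.exp_add]
    ring_nf
  · have hs := Real.sinh_pos_iff.2 hpy
    have e : Real.exp (-(2 * π * y)) = Real.exp (-(π * y)) * Real.exp (-(π * y)) := by
      rw [← Real.exp_add]; ring_nf
    have hmul : Real.exp (π * y) * Real.exp (-(π * y)) = 1 := by
      rw [← Real.exp_add]; simp
    rw [planckWeight, ← div_eq_mul_inv, div_eq_div_iff (by positivity) (by linarith),
      e, Real.sinh_eq]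
    linear_combination -Real.exp (-(π * y)) * hmul

/-- The sine transform of `1 / (exp (2 * π * y) - 1)`. -/
lemma integral_sin_mul_planckWeight {x : ℝ} (hx : 0 < x) :
    ∫ y in Set.Ioi 0, Real.sin (2 * π * x * y) * planckWeight y =
      (Real.cosh (π * x) / Real.sinh (π * x) - 1 / (π * x)) / 4 := by
  have hb : ∀ n : ℕ, 0 < 2 * π * ((n : ℝ) + 1) := fun n => by positivity
  have hle : ∀ n : ℕ, ∀ y ∈ Set.Ioi (0 : ℝ),
      ‖Real.sin (2 * π * x * y) * Real.exp (-(2 * π * (n + 1)) * y)‖ ≤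
        2 * π * x * (y * Real.exp (-(2 * π * (n + 1)) * y)) := by
    intro n y hy
    have hy : 0 < y := hy
    rw [norm_mul, Real.norm_eq_abs, Real.norm_eq_abs, Real.abs_exp, ← mul_assoc]
    gcongr
    exact Real.abs_sin_le_abs.trans_eq (abs_of_pos (by positivity))
  have hint : ∀ n : ℕ, Integrable
      (fun y => Real.sin (2 * π * x * y) * Real.exp (-(2 * π * (n + 1)) * y))
      (volume.restrict (Set.Ioi 0)) := fun n =>
    ((integrableOn_mul_exp_neg (hb n)).const_mul (2 * π * x)).mono' (by fun_prop)
      ((ae_restrict_iff' measurableSet_Ioi).2 (ae_of_all _ (hle n)))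
  have hsum : Summable fun n : ℕ => ∫ y in Set.Ioi 0,
      ‖Real.sin (2 * π * x * y) * Real.exp (-(2 * π * (n + 1)) * y)‖ := by
    refine Summable.of_nonneg_of_le (fun n => integral_nonneg fun y => norm_nonneg _)
      (fun n => ?_) (((summable_nat_add_iff 1).2
        (Real.summable_one_div_nat_pow.2 one_lt_two)).mul_left (x / (2 * π)))
    refine (setIntegral_mono_on (hint n).norm ((integrableOn_mul_exp_neg (hb n)).const_mul
      (2 * π * x)) measurableSet_Ioi (hle n)).trans_eq ?_
    rw [integral_const_mul, integral_mul_exp_neg (hb n)]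
    push_cast
    field_simp
  have h := hasSum_integral_of_summable_integral_norm hint hsum
  have e : ∫ y in Set.Ioi 0, ∑' n : ℕ,
      Real.sin (2 * π * x * y) * Real.exp (-(2 * π * (n + 1)) * y) =
      ∫ y in Set.Ioi 0, Real.sin (2 * π * x * y) * planckWeight y :=
    setIntegral_congr_fun measurableSet_Ioi fun y hy =>
      ((hasSum_planckWeight hy).mul_left _).tsum_eq
  rw [e] at h
  refine h.unique ?_
  convert! (hasSum_coth hx).mul_left (1 / (4 * π)) using 1
  · ext n
    rw [integral_sin_mul_exp_neg _ (hb n)]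
    field_simp
    ring
  · field_simp

lemma integrable_hermiteThree_mul_sin_mul_planckWeight :
    Integrable (Function.uncurry fun x y =>
        hermiteThree x * (Real.sin (2 * π * x * y) * planckWeight y))
      ((volume.restrict (Set.Ioi 0)).prod (volume.restrict (Set.Ioi 0))) := by
  have hexp : IntegrableOn (fun y : ℝ => Real.exp (-π * y)) (Set.Ioi 0) :=
    exp_neg_integrableOn_Ioi 0 pi_pos
  refine (integrableOn_mul_hermiteThree.norm.mul_prod hexp).mono' ?_ ?_
  · have := continuous_hermiteThree.measurable
    unfold planckWeight Function.uncurry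
    exact Measurable.aestronglyMeasurable (by fun_prop)
  · rw [Measure.prod_restrict, ae_restrict_iff' (measurableSet_Ioi.prod measurableSet_Ioi)]
    refine ae_of_all _ ?_
    rintro ⟨x, y⟩ ⟨hx, hy⟩
    have hx : 0 < x := hx
    have hy : 0 < y := hy
    simp only [Function.uncurry, norm_mul, Real.norm_eq_abs, abs_of_pos hx,
      abs_of_nonneg (planckWeight_nonneg hy)]
    calc |hermiteThree x| * (|Real.sin (2 * π * x * y)| * planckWeight y)
        ≤ |hermiteThree x| * ((2 * π * x * y) * planckWeight y) := by
          have := planckWeight_nonneg hy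
          gcongr
          exact Real.abs_sin_le_abs.trans_eq (abs_of_pos (by positivity))
      _ = x * |hermiteThree x| * (2 * π * y * planckWeight y) := by ring
      _ ≤ x * |hermiteThree x| * Real.exp (-π * y) := by
          gcongr
          exact mul_planckWeight_le hy

theorem russell_integral_10 :
    ∫ x in Set.Ioi (0:ℝ),
      x * (3 - 4 * π * x^2) * Real.exp (-π * x * (x + 1)) / Real.sinh (π * x) =
    1 / (2 * π) := by
  have hF := integrable_hermiteThree_mul_sin_mul_planckWeight
  have hswap := integral_integral_swap hF
  have hK := hF.integral_prod_left
  simp only [Function.uncurry, integral_const_mul] at hK hswap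
  have hright : ∫ y in Set.Ioi 0, ∫ x in Set.Ioi 0,
      hermiteThree x * (Real.sin (2 * π * x * y) * planckWeight y) =
      ∫ y in Set.Ioi 0, -(1 / 4) * (2 * hermiteThree y * planckWeight y) := by
    refine integral_congr_ae (ae_of_all _ fun y => ?_)
    simp only [← mul_assoc, integral_mul_const, integral_hermiteThree_mul_sin]
    ring
  rw [hright, integral_const_mul] at hswap
  have hI : ∫ x in Set.Ioi (0:ℝ),
      x * (3 - 4 * π * x^2) * Real.exp (-π * x * (x + 1)) / Real.sinh (π * x) =
      ∫ y in Set.Ioi 0, 2 * hermiteThree y * planckWeight y := by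
    refine integral_congr_ae (ae_of_all _ fun x => ?_)
    have e : Real.exp (-π * x * (x + 1)) = Real.exp (-π * x ^ 2) * Real.exp (-(π * x)) := by
      rw [← Real.exp_add]; ring_nf
    simp only [hermiteThree, planckWeight, e]
    ring
  have hsplit : ∫ y in Set.Ioi 0, 2 * hermiteThree y * planckWeight y =
      ∫ x in Set.Ioi 0, (4 * (hermiteThree x *
        ∫ y in Set.Ioi 0, Real.sin (2 * π * x * y) * planckWeight y) +
        1 / π * ((3 - 4 * π * x ^ 2) * Real.exp (-π * x ^ 2)) - hermiteThree x) := by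
    refine setIntegral_congr_fun measurableSet_Ioi fun x hx => ?_
    have hx : 0 < x := hx
    have hs := Real.sinh_pos_iff.2 (mul_pos pi_pos hx)
    simp only [integral_sin_mul_planckWeight hx]
    rw [planckWeight, ← Real.cosh_sub_sinh, hermiteThree]
    field_simp
    ring
  have hadd : IntegrableOn (fun x => 4 * (hermiteThree x *
      ∫ y in Set.Ioi 0, Real.sin (2 * π * x * y) * planckWeight y) +
      1 / π * ((3 - 4 * π * x ^ 2) * Real.exp (-π * x ^ 2))) (Set.Ioi 0) :=
    (hK.const_mul 4).add (integrableOn_quadratic_mul_gaussian.const_mul _)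
  rw [integral_sub hadd integrableOn_hermiteThree, integral_add (hK.const_mul 4)
    (integrableOn_quadratic_mul_gaussian.const_mul _), integral_const_mul, integral_const_mul,
    integral_quadratic_mul_gaussian, integral_hermiteThree, hswap] at hsplit
  rw [hI]
  have : 1 / π * (1 / 2) = 1 / (2 * π) := by ring
  linarith
end

section
/- ∫₀^∞ (sin²x / (cosh x + cos x)) (1/x²) dx + (2/π) ∫₀^{e^{-π/2}} (arctan x)/x dx = π/4. -/
open Real MeasureTheory

open scoped FourierTransform

theorem integrable_exp_neg_mul_abs {c : ℂ} (hc : 0 < c.re) :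
    Integrable fun t : ℝ => Complex.exp (-c * |t|) := by
  rw [← integrableOn_univ, ← Set.Iic_union_Ioi (a := (0 : ℝ))]
  refine IntegrableOn.union ?_ ?_
  · refine (integrableOn_exp_mul_complex_Iic hc 0).congr_fun (fun t ht => ?_) measurableSet_Iic
    simp [abs_of_nonpos (Set.mem_Iic.1 ht)]
  · refine (integrableOn_exp_mul_complex_Ioi (a := -c) (by simpa) 0).congr_fun (fun t ht => ?_)
      measurableSet_Ioi
    simp [abs_of_pos (Set.mem_Ioi.1 ht)]

theorem fourier_exp_neg_mul_abs {c : ℂ} (hc : 0 < c.re) (w : ℝ) :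
    𝓕 (fun t : ℝ => Complex.exp (-c * |t|)) w = 2 * c * (((2 * π * w : ℝ) : ℂ) ^ 2 + c ^ 2)⁻¹ := by
  rw [Real.fourier_real_eq_integral_exp_smul]
  have hinteg : Integrable fun t : ℝ =>
      Complex.exp (↑(-2 * π * t * w) * Complex.I) • Complex.exp (-c * |t|) := by
    refine (integrable_exp_neg_mul_abs hc).norm.mono' (by fun_prop) (.of_forall fun t => ?_)
    rw [norm_smul, Complex.norm_exp_ofReal_mul_I, one_mul]
  rw [← intervalIntegral.integral_Iic_add_Ioi (b := 0) hinteg.integrableOn hinteg.integrableOn]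
  set v : ℂ := ((2 * π * w : ℝ) : ℂ) * Complex.I with hv
  have hvre : v.re = 0 := by rw [hv, Complex.re_ofReal_mul, Complex.I_re, mul_zero]
  have h1 : ∫ t : ℝ in Set.Iic 0,
      Complex.exp (↑(-2 * π * t * w) * Complex.I) • Complex.exp (-c * |t|) = 1 / (c - v) := by
    rw [setIntegral_congr_fun (g := fun t : ℝ => Complex.exp ((c - v) * t)) measurableSet_Iic,
      integral_exp_mul_complex_Iic (by simpa [hvre] using hc)]
    · simp
    · intro t ht
      simp only [smul_eq_mul, ← Complex.exp_add, abs_of_nonpos (Set.mem_Iic.1 ht), hv]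
      congr 1
      push_cast
      ring
  have h2 : ∫ t : ℝ in Set.Ioi 0,
      Complex.exp (↑(-2 * π * t * w) * Complex.I) • Complex.exp (-c * |t|) = 1 / (c + v) := by
    rw [setIntegral_congr_fun (g := fun t : ℝ => Complex.exp (-(c + v) * t)) measurableSet_Ioi,
      integral_exp_mul_complex_Ioi (by simpa [hvre] using hc)]
    · rw [Complex.ofReal_zero, mul_zero, Complex.exp_zero, neg_div_neg_eq]
    · intro t ht
      simp only [smul_eq_mul, ← Complex.exp_add, abs_of_pos (Set.mem_Ioi.1 ht), hv]
      congr 1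
      push_cast
      ring
  have hne1 : c - v ≠ 0 := fun h => by
    have := congrArg Complex.re h
    simp [hvre] at this
    linarith
  have hne2 : c + v ≠ 0 := fun h => by
    have := congrArg Complex.re h
    simp [hvre] at this
    linarith
  have hprod : ((2 * π * w : ℝ) : ℂ) ^ 2 + c ^ 2 = (c - v) * (c + v) := by
    rw [hv]
    linear_combination ((2 * π * w : ℝ) : ℂ) ^ 2 * Complex.I_sq
  rw [h1, h2, hprod]
  field_simp
  ring

theorem integral_exp_mul_I_mul_inv_sq_add_sq {c : ℂ} (hc : 0 < c.re)
    (hinteg : Integrable fun x : ℝ => ((x : ℂ) ^ 2 + c ^ 2)⁻¹) (a : ℝ) :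
    ∫ x : ℝ, Complex.exp (x * a * Complex.I) * ((x : ℂ) ^ 2 + c ^ 2)⁻¹ =
      π / c * Complex.exp (-c * |a|) := by
  have hF : 𝓕 (fun t : ℝ => Complex.exp (-c * |t|)) =
      fun w : ℝ => 2 * c * (((2 * π * w : ℝ) : ℂ) ^ 2 + c ^ 2)⁻¹ :=
    funext (fourier_exp_neg_mul_abs hc)
  have hFint : Integrable (𝓕 (fun t : ℝ => Complex.exp (-c * |t|))) := by
    rw [hF]
    exact (hinteg.comp_mul_left' (by positivity : 2 * π ≠ 0)).const_mul (2 * c)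
  have hinv := congrFun (Continuous.fourierInv_fourier_eq (by fun_prop)
    (integrable_exp_neg_mul_abs hc) hFint) a
  rw [hF, Real.fourierInv_eq'] at hinv
  have hcv := Measure.integral_comp_mul_left
    (fun x : ℝ => Complex.exp (x * a * Complex.I) * ((x : ℂ) ^ 2 + c ^ 2)⁻¹) (2 * π)
  have hcongr : (∫ v : ℝ, Complex.exp (↑(2 * π * inner ℝ v a) * Complex.I) •
      (2 * c * (((2 * π * v : ℝ) : ℂ) ^ 2 + c ^ 2)⁻¹)) =
      2 * c * ∫ v : ℝ, Complex.exp (((2 * π * v : ℝ) : ℂ) * a * Complex.I) *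
        ((((2 * π * v : ℝ) : ℂ)) ^ 2 + c ^ 2)⁻¹ := by
    rw [← integral_const_mul]
    congr 1 with v
    have : ((2 * π * inner ℝ v a : ℝ) : ℂ) = ((2 * π * v : ℝ) : ℂ) * a := by
      simp
      ring
    rw [this, smul_eq_mul]
    ring
  rw [hcongr, hcv] at hinv
  rw [← hinv, abs_of_pos (by positivity), Complex.real_smul]
  have hc0 : c ≠ 0 := fun h => by simp [h] at hc
  have hpi : (π : ℂ) ≠ 0 := by exact_mod_cast pi_ne_zero
  generalize (∫ x : ℝ, Complex.exp (x * a * Complex.I) * ((x : ℂ) ^ 2 + c ^ 2)⁻¹) = J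
  push_cast
  field_simp

theorem integral_sinc_mul_inv_sq_add_sq {c : ℂ} (hc : 0 < c.re)
    (hinteg : Integrable fun x : ℝ => ((x : ℂ) ^ 2 + c ^ 2)⁻¹) :
    ∫ x : ℝ, (sinc x : ℂ) * ((x : ℂ) ^ 2 + c ^ 2)⁻¹ =
      π / c ^ 2 * (1 - Complex.exp (-c)) := by
  have hc0 : c ≠ 0 := fun h => by simp [h] at hc
  have hswap := intervalIntegral_integral_swap (a := -1) (b := 1) (μ := (volume : Measure ℝ))
    (f := fun a x : ℝ => Complex.exp (x * a * Complex.I) * ((x : ℂ) ^ 2 + c ^ 2)⁻¹) (by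
      rw [Set.uIoc_of_le (by norm_num)]
      have h := (integrable_const (μ := volume.restrict (Set.Ioc (-1 : ℝ) 1)) (1 : ℂ)).mul_prod hinteg
      refine h.norm.mono' ?_ (.of_forall fun p => ?_)
      · have h2 := h.aestronglyMeasurable
        have h1 : AEStronglyMeasurable (fun p : ℝ × ℝ => Complex.exp (p.2 * p.1 * Complex.I))
          ((volume.restrict (Set.Ioc (-1 : ℝ) 1)).prod (volume : Measure ℝ)) := by fun_prop
        simp only [one_mul] at h2
        exact h1.mul h2
      · simp only [Function.uncurry]
        rw [norm_mul, ← Complex.ofReal_mul, Complex.norm_exp_ofReal_mul_I]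
        simp)
  have hleft : ∫ a : ℝ in (-1)..1, ∫ x : ℝ, Complex.exp (x * a * Complex.I) *
      ((x : ℂ) ^ 2 + c ^ 2)⁻¹ = 2 * (π / c ^ 2 * (1 - Complex.exp (-c))) := by
    simp_rw [integral_exp_mul_I_mul_inv_sq_add_sq hc hinteg]
    rw [intervalIntegral.integral_const_mul]
    have hi : ∀ a b : ℝ, IntervalIntegrable (fun t : ℝ => Complex.exp (-c * |t|)) volume a b :=
      fun a b => (by fun_prop : Continuous fun t : ℝ => Complex.exp (-c * |t|)).intervalIntegrable _ _
    have h1 : ∫ t : ℝ in (-1)..0, Complex.exp (-c * |t|) = (1 - Complex.exp (-c)) / c := by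
      rw [intervalIntegral.integral_congr (g := fun t : ℝ => Complex.exp (c * t)),
        integral_exp_mul_complex hc0]
      · simp
      · intro t ht
        rw [Set.uIcc_of_le (by norm_num)] at ht
        simp [abs_of_nonpos ht.2]
    have h2 : ∫ t : ℝ in 0..1, Complex.exp (-c * |t|) = (1 - Complex.exp (-c)) / c := by
      rw [intervalIntegral.integral_congr (g := fun t : ℝ => Complex.exp (-c * t)),
        integral_exp_mul_complex (neg_ne_zero.2 hc0)]
      · simp only [Complex.ofReal_one, mul_one, Complex.ofReal_zero, mul_zero, Complex.exp_zero]
        field_simp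
        ring
      · intro t ht
        rw [Set.uIcc_of_le (by norm_num)] at ht
        simp [abs_of_nonneg ht.1]
    rw [← intervalIntegral.integral_add_adjacent_intervals (hi (-1) 0) (hi 0 1), h1, h2]
    field_simp
    ring
  have hright : ∀ x : ℝ, ∫ a : ℝ in (-1)..1, Complex.exp (x * a * Complex.I) *
      ((x : ℂ) ^ 2 + c ^ 2)⁻¹ = 2 * ((sinc x : ℂ) * ((x : ℂ) ^ 2 + c ^ 2)⁻¹) := by
    intro x
    rw [intervalIntegral.integral_mul_const, ← mul_assoc]
    congr 1
    rcases eq_or_ne x 0 with rfl | hx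
    · norm_num
    · have hxI : (x : ℂ) * Complex.I ≠ 0 := by simp [hx]
      have : ∀ a : ℝ, (x : ℂ) * a * Complex.I = x * Complex.I * a := fun a => by ring
      simp_rw [this]
      rw [integral_exp_mul_complex hxI, sinc_of_ne_zero hx]
      have hx' : (x : ℂ) ≠ 0 := by exact_mod_cast hx
      push_cast
      rw [Complex.sin]
      field_simp
      simp only [Complex.I_sq]
      ring_nf
  rw [hleft] at hswap
  simp_rw [hright] at hswap
  rw [integral_const_mul] at hswap
  exact (mul_left_cancel₀ two_ne_zero hswap).symm

theorem hasSum_one_div_odd_sq :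
    HasSum (fun k : ℕ => 1 / (2 * k + 1 : ℝ) ^ 2) (π ^ 2 / 8) := by
  let f : ℕ → ℝ := fun n => 1 / (n : ℝ) ^ 2
  have hf : HasSum f (π ^ 2 / 6) := hasSum_zeta_two
  have hodd : Summable fun k : ℕ => f (2 * k + 1) :=
    hf.summable.comp_injective (i := fun k : ℕ => 2 * k + 1) fun a b h => by simpa using h
  have heven : HasSum (fun k : ℕ => f (2 * k)) (1 / 4 * (π ^ 2 / 6)) := by
    refine (hf.mul_left (1 / 4)).congr_fun fun k => ?_
    simp only [f]
    push_cast
    rw [mul_pow, one_div_mul_one_div]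
    norm_num
  have h := (heven.even_add_odd hodd.hasSum).unique hf
  rw [show π ^ 2 / 8 = ∑' k, f (2 * k + 1) by linarith]
  exact hodd.hasSum.congr_fun fun k => by simp [f]

theorem hasSum_setIntegral_arctan_div {y : ℝ} (hy0 : 0 < y) (hy1 : y < 1) :
    HasSum (fun k : ℕ => (-1) ^ k * y ^ (2 * k + 1) / (2 * k + 1 : ℝ) ^ 2)
      (∫ x in Set.Ioo 0 y, Real.arctan x / x) := by
  have h := hasSum_integral_of_dominated_convergence (μ := volume.restrict (Set.Ioo 0 y))
    (F := fun (k : ℕ) (x : ℝ) => (-1) ^ k * x ^ (2 * k) / (2 * k + 1 : ℝ))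
    (f := fun x => Real.arctan x / x) (bound := fun k _ => (y ^ 2) ^ k)
    (fun k => by fun_prop) (fun k => ?_) (.of_forall fun _ => ?_) (by fun_prop) ?_
  · refine h.congr_fun fun k => ?_
    rw [integral_div, integral_const_mul, ← integral_Ioc_eq_integral_Ioo,
      ← intervalIntegral.integral_of_le hy0.le, integral_pow]
    push_cast
    field_simp
    ring
  · filter_upwards [ae_restrict_mem measurableSet_Ioo] with x hx
    have hk : (1 : ℝ) ≤ 2 * k + 1 := by linarith [(Nat.cast_nonneg k : (0 : ℝ) ≤ k)]
    rw [norm_div, norm_mul, norm_pow, norm_neg, norm_one, one_pow, one_mul,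
      Real.norm_of_nonneg (by positivity : (0 : ℝ) ≤ 2 * k + 1),
      Real.norm_of_nonneg (by have := hx.1; positivity), pow_mul]
    have hx0 := hx.1.le
    have hxy := hx.2.le
    calc (x ^ 2) ^ k / (2 * k + 1 : ℝ) ≤ (x ^ 2) ^ k := div_le_self (by positivity) hk
      _ ≤ (y ^ 2) ^ k := by gcongr
  · exact summable_geometric_of_lt_one (by positivity) (by nlinarith)
  · filter_upwards [ae_restrict_mem measurableSet_Ioo] with x hx
    have hx1 : ‖x‖ < 1 := by
      rw [Real.norm_of_nonneg hx.1.le]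
      exact hx.2.trans hy1
    refine ((Real.hasSum_arctan hx1).div_const x).congr_fun fun k => ?_
    have := hx.1.ne'
    push_cast
    field_simp
    ring

theorem hasSum_pi_mul_tan {z : ℂ} (hz : 2 * z ∈ Complex.integerComplement) :
    HasSum (fun k : ℕ => 8 * z / ((2 * k + 1) ^ 2 - 4 * z ^ 2)) (π * Complex.tan (π * z)) := by
  have hne : ∀ n : ℤ, 2 * z ≠ n := fun n h => hz ⟨n, h.symm⟩
  have hz' : z ∈ Complex.integerComplement := by
    rintro ⟨n, rfl⟩
    exact hne (2 * n) (by push_cast; ring)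
  have h1 := (summable_cotTerm hz').hasSum
  have h2 := (summable_cotTerm hz).hasSum
  have hodd : Summable fun k : ℕ => cotTerm (2 * z) (2 * k + 1) :=
    (summable_cotTerm hz).comp_injective (i := fun k : ℕ => 2 * k + 1) fun a b h => by simpa using h
  have heven : Summable fun k : ℕ => cotTerm (2 * z) (2 * k) :=
    (summable_cotTerm hz).comp_injective (i := fun k : ℕ => 2 * k) fun a b h => by simpa using h
  have hodd' : HasSum (fun k : ℕ => cotTerm (2 * z) (2 * k + 1)) (1 / 2 * ∑' n, cotTerm z n) := by
    refine (h1.mul_left (1 / 2)).congr_fun fun k => ?_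
    have e1 : z - (k + 1) ≠ 0 := fun h => hne (2 * (k + 1)) (by push_cast; linear_combination 2 * h)
    have e2 : z + (k + 1) ≠ 0 := fun h => hne (-(2 * (k + 1))) (by push_cast; linear_combination 2 * h)
    have e3 : 2 * z - (2 * k + 1 + 1) = 2 * (z - (k + 1)) := by ring
    have e4 : 2 * z + (2 * k + 1 + 1) = 2 * (z + (k + 1)) := by ring
    simp only [cotTerm]
    push_cast
    rw [e3, e4]
    field_simp
  have hsum := (heven.hasSum.even_add_odd hodd').unique h2
  have hc1 := cot_series_rep' hz'
  have hc2 := cot_series_rep' hz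
  rw [show ∑' n, cotTerm z n = π * Complex.cot (π * z) - 1 / z from hc1.symm,
    show ∑' n, cotTerm (2 * z) n = π * Complex.cot (π * (2 * z)) - 1 / (2 * z) from hc2.symm]
    at hsum
  have hs1 : Complex.sin (π * z) ≠ 0 := sin_pi_mul_ne_zero hz'
  have hs2 : Complex.sin (π * (2 * z)) ≠ 0 := sin_pi_mul_ne_zero hz
  have e : (π : ℂ) * (2 * z) = 2 * (π * z) := by ring
  rw [e, Complex.sin_two_mul] at hs2
  have hcos : Complex.cos (π * z) ≠ 0 := right_ne_zero_of_mul hs2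
  have hz0 : z ≠ 0 := fun h => hne 0 (by simp [h])
  have htan : π * Complex.tan (π * z) = -2 * ∑' k : ℕ, cotTerm (2 * z) (2 * k) := by
    rw [eq_sub_of_add_eq hsum, e, Complex.cot, Complex.cot, Complex.tan, Complex.sin_two_mul,
      Complex.cos_two_mul]
    field_simp
    linear_combination z * π * Complex.sin_sq_add_cos_sq (π * z)
  rw [htan]
  refine (heven.hasSum.mul_left (-2)).congr_fun fun k => ?_
  have e1 : 2 * z - (2 * k + 1) ≠ 0 := fun h => hne (2 * k + 1) (by
    push_cast
    linear_combination h)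
  have e2 : 2 * z + (2 * k + 1) ≠ 0 := fun h => hne (-(2 * k + 1)) (by
    push_cast
    linear_combination h)
  have e3 : ((2 * k + 1) ^ 2 - 4 * z ^ 2 : ℂ) =
      -((2 * z - (2 * k + 1)) * (2 * z + (2 * k + 1))) := by ring
  have e4 : 8 * z = 2 * ((2 * z - (2 * k + 1)) + (2 * z + (2 * k + 1))) := by ring
  rw [e3, e4, cotTerm]
  push_cast
  generalize 2 * z - (2 * k + 1 : ℂ) = A at *
  generalize 2 * z + (2 * k + 1 : ℂ) = B at *
  field_simp
  ring

theorem cosh_add_cos_pos {x : ℝ} (hx : x ≠ 0) : 0 < Real.cosh x + Real.cos x := by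
  linarith [Real.one_lt_cosh.2 hx, Real.neg_one_le_cos x]

theorem re_tan_mul_one_sub_I_div_two (x : ℝ) :
    (Complex.tan (x * (1 - Complex.I) / 2)).re =
      Real.sin x / (Real.cosh x + Real.cos x) := by
  have hw : (x : ℂ) * (1 - Complex.I) / 2 = ((x / 2 : ℝ) : ℂ) - ((x / 2 : ℝ) : ℂ) * Complex.I := by
    push_cast
    ring
  have hx : x = 2 * (x / 2) := by ring
  have hs : Real.sin x = 2 * Real.sin (x / 2) * Real.cos (x / 2) := by
    conv_lhs => rw [hx, Real.sin_two_mul]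
  have hc : Real.cos x = 2 * Real.cos (x / 2) ^ 2 - 1 := by
    conv_lhs => rw [hx, Real.cos_two_mul]
  have hch : Real.cosh x = Real.cosh (x / 2) ^ 2 + Real.sinh (x / 2) ^ 2 := by
    conv_lhs => rw [hx, Real.cosh_two_mul]
  generalize x / 2 = u at *
  rw [hs, hc, hch, hw, Complex.tan, Complex.sin_sub, Complex.cos_sub, Complex.sin_mul_I,
    Complex.cos_mul_I, Complex.div_re, Complex.normSq_apply]
  simp [Complex.sin_ofReal_re, Complex.cos_ofReal_re, Complex.sinh_ofReal_re]
  have h1 := Real.sin_sq_add_cos_sq (u)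
  have h2 := Real.cosh_sq (u)
  generalize Real.sin (u) = s at *
  generalize Real.cos (u) = c at *
  generalize Real.sinh (u) = h at *
  generalize Real.cosh (u) = g at *
  have hd : c * g * (c * g) + s * h * (s * h) = (g ^ 2 + h ^ 2 + (2 * c ^ 2 - 1)) / 2 := by
    linear_combination h ^ 2 * h1 + (c ^ 2 - 1 / 2) * h2
  rw [hd, ← add_div, div_div_eq_mul_div]
  congr 1
  linear_combination 2 * s * c * h2

theorem norm_sq_add_sq_lower_bound {M x : ℝ} (hM : 0 ≤ M) :
    (x ^ 2 + M) / 2 ≤ ‖(x : ℂ) ^ 2 - M * Complex.I‖ := by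
  have hre := Complex.abs_re_le_norm ((x : ℂ) ^ 2 - M * Complex.I)
  have him := Complex.abs_im_le_norm ((x : ℂ) ^ 2 - M * Complex.I)
  simp [← Complex.ofReal_pow] at hre him
  rw [abs_of_nonneg hM] at him
  push_cast at hre him
  linarith

/-- The poles of `x ↦ tan (x * (1 - I) / 2)` are the points `I * tanPole k` and their opposites. -/
noncomputable def tanPole (k : ℕ) : ℂ := ((2 * k + 1) * π / 2 : ℝ) * (1 - Complex.I)

theorem tanPole_sq (k : ℕ) :
    tanPole k ^ 2 = -(((2 * k + 1) ^ 2 * π ^ 2 / 2 : ℝ) : ℂ) * Complex.I := by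
  rw [tanPole]
  push_cast
  linear_combination ((2 * k + 1) * π / 2 : ℂ) ^ 2 * Complex.I_sq

theorem re_tanPole_pos (k : ℕ) : 0 < (tanPole k).re := by
  rw [tanPole, Complex.re_ofReal_mul]
  simp
  positivity

theorem exp_neg_tanPole (k : ℕ) :
    Complex.exp (-tanPole k) =
      ((-1) ^ k * Real.exp (-π / 2) ^ (2 * k + 1) : ℝ) * Complex.I := by
  have h : -tanPole k = ((2 * k + 1 : ℕ) : ℂ) * ((-π / 2 : ℝ) : ℂ) +
      (k * (π * Complex.I) + π / 2 * Complex.I) := by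
    rw [tanPole]
    push_cast
    ring
  rw [h, Complex.exp_add, Complex.exp_add, Complex.exp_nat_mul, Complex.exp_nat_mul,
    Complex.exp_pi_mul_I, Complex.exp_pi_div_two_mul_I]
  push_cast
  ring

theorem norm_inv_sq_add_tanPole_sq_le (k : ℕ) (x : ℝ) :
    ‖((x : ℂ) ^ 2 + tanPole k ^ 2)⁻¹‖ ≤
      2 * ((2 * k + 1 : ℝ) ^ (-(3 / 2) : ℝ) * (1 + x ^ 2) ^ (-(1 / 4) : ℝ)) := by
  set m : ℝ := 2 * k + 1 with hm
  have hm1 : 1 ≤ m := by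
    have : (0 : ℝ) ≤ k := Nat.cast_nonneg k
    linarith
  have hpi : 1 ≤ π ^ 2 / 2 := by nlinarith [pi_gt_three]
  have hM : m ^ 2 ≤ m ^ 2 * π ^ 2 / 2 := by nlinarith [sq_nonneg m]
  have hlow := norm_sq_add_sq_lower_bound (M := m ^ 2 * π ^ 2 / 2) (x := x) (by positivity)
  have heq : (x : ℂ) ^ 2 + tanPole k ^ 2 =
      (x : ℂ) ^ 2 - ((m ^ 2 * π ^ 2 / 2 : ℝ) : ℂ) * Complex.I := by
    rw [tanPole_sq]
    ring
  have hprod : m ^ (3 / 2 : ℝ) * (1 + x ^ 2) ^ (1 / 4 : ℝ) ≤ x ^ 2 + m ^ 2 * π ^ 2 / 2 := by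
    set B := x ^ 2 + m ^ 2 * π ^ 2 / 2 with hBdef
    have hB : 0 < B := by positivity
    have hB1 : m ^ 2 ≤ B := by linarith [sq_nonneg x]
    have hB2 : 1 + x ^ 2 ≤ B := by nlinarith
    have h1 : m ^ (3 / 2 : ℝ) ≤ B ^ (3 / 4 : ℝ) := by
      have : m ^ (3 / 2 : ℝ) = (m ^ 2) ^ (3 / 4 : ℝ) := by
        rw [← Real.rpow_natCast, ← Real.rpow_mul (by positivity)]
        norm_num
      rw [this]
      exact Real.rpow_le_rpow (by positivity) hB1 (by norm_num)
    have h2 : (1 + x ^ 2) ^ (1 / 4 : ℝ) ≤ B ^ (1 / 4 : ℝ) :=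
      Real.rpow_le_rpow (by positivity) hB2 (by norm_num)
    calc m ^ (3 / 2 : ℝ) * (1 + x ^ 2) ^ (1 / 4 : ℝ) ≤ B ^ (3 / 4 : ℝ) * B ^ (1 / 4 : ℝ) := by
          gcongr
      _ = B := by
          rw [← Real.rpow_add hB]
          norm_num
  rw [heq, norm_inv, Real.rpow_neg (by positivity), Real.rpow_neg (by positivity), ← mul_inv]
  refine inv_le_of_inv_le₀ (by positivity) ?_
  rw [mul_inv, inv_inv]
  linarith

theorem continuous_inv_sq_add_tanPole_sq (k : ℕ) :
    Continuous fun x : ℝ => ((x : ℂ) ^ 2 + tanPole k ^ 2)⁻¹ := by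
  refine Continuous.inv₀ (by fun_prop) fun x h => ?_
  have hlow := norm_sq_add_sq_lower_bound (M := (2 * k + 1) ^ 2 * π ^ 2 / 2) (x := x) (by positivity)
  rw [tanPole_sq, neg_mul, ← sub_eq_add_neg] at h
  rw [h, norm_zero] at hlow
  have : 0 < (x ^ 2 + (2 * k + 1) ^ 2 * π ^ 2 / 2) / 2 := by positivity
  linarith

theorem integrable_inv_sq_add_tanPole_sq (k : ℕ) :
    Integrable fun x : ℝ => ((x : ℂ) ^ 2 + tanPole k ^ 2)⁻¹ := by
  refine (integrable_inv_one_add_sq.const_mul 2).mono'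
    (continuous_inv_sq_add_tanPole_sq k).aestronglyMeasurable (.of_forall fun x => ?_)
  have hlow := norm_sq_add_sq_lower_bound (M := (2 * k + 1) ^ 2 * π ^ 2 / 2) (x := x) (by positivity)
  have hM : 1 ≤ (2 * k + 1 : ℝ) ^ 2 * π ^ 2 / 2 := by
    have : (0 : ℝ) ≤ k := Nat.cast_nonneg k
    have h1 : 1 ≤ (2 * k + 1 : ℝ) ^ 2 := by nlinarith
    nlinarith [pi_gt_three]
  rw [tanPole_sq, neg_mul, ← sub_eq_add_neg, norm_inv]
  refine inv_le_of_inv_le₀ (by positivity) ?_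
  rw [mul_inv, inv_inv]
  linarith

theorem abs_sinc_le (x : ℝ) : |sinc x| ≤ 2 * (1 + x ^ 2) ^ (-(1 / 2) : ℝ) := by
  have hs : sinc x * x = Real.sin x := by
    rcases eq_or_ne x 0 with rfl | hx
    · simp
    · rw [sinc_of_ne_zero hx, div_mul_cancel₀ _ hx]
  have h1 : sinc x ^ 2 ≤ 1 := by
    rw [sq_le_one_iff_abs_le_one]
    exact abs_sinc_le_one x
  have h2 : (sinc x * x) ^ 2 ≤ 1 := by
    rw [hs]
    exact Real.sin_sq_le_one x
  rw [Real.rpow_neg (by positivity), ← Real.sqrt_eq_rpow, ← div_eq_mul_inv,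
    le_div_iff₀ (by positivity)]
  refine abs_le_of_sq_le_sq' ?_ (by norm_num) |>.2
  rw [mul_pow, sq_abs, Real.sq_sqrt (by positivity)]
  nlinarith

/-- The `k`-th term of the partial fraction expansion of `sin x / (x * (cosh x + cos x))`. -/
noncomputable def tanTerm (k : ℕ) (x : ℝ) : ℝ :=
  (-2 * (1 + Complex.I) * ((x : ℂ) ^ 2 + tanPole k ^ 2)⁻¹).re

theorem abs_tanTerm_le (k : ℕ) (x : ℝ) :
    |tanTerm k x| ≤ 8 * ((2 * k + 1 : ℝ) ^ (-(3 / 2) : ℝ) * (1 + x ^ 2) ^ (-(1 / 4) : ℝ)) := by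
  have hI : ‖-2 * (1 + Complex.I)‖ ≤ 4 := by
    rw [norm_mul, norm_neg, Complex.norm_ofNat]
    have := norm_add_le 1 Complex.I
    rw [norm_one, Complex.norm_I] at this
    linarith
  calc |tanTerm k x| ≤ ‖-2 * (1 + Complex.I)‖ * ‖((x : ℂ) ^ 2 + tanPole k ^ 2)⁻¹‖ := by
        rw [← norm_mul]
        exact Complex.abs_re_le_norm _
    _ ≤ 4 * (2 * ((2 * k + 1 : ℝ) ^ (-(3 / 2) : ℝ) * (1 + x ^ 2) ^ (-(1 / 4) : ℝ))) := by
        gcongr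
        exact norm_inv_sq_add_tanPole_sq_le k x
    _ = _ := by ring

theorem hasSum_tanTerm {x : ℝ} (hx : x ≠ 0) :
    HasSum (fun k => tanTerm k x) (Real.sin x / (x * (Real.cosh x + Real.cos x))) := by
  have hpi : (π : ℂ) ≠ 0 := by exact_mod_cast pi_ne_zero
  have hx' : (x : ℂ) ≠ 0 := by exact_mod_cast hx
  set z : ℂ := x * (1 - Complex.I) / (2 * π) with hz
  have hzc : 2 * z ∈ Complex.integerComplement := by
    rintro ⟨n, hn⟩
    have h1 : (n : ℂ) * π = x * (1 - Complex.I) := by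
      rw [hn, hz]
      field_simp
    have := congrArg Complex.im h1
    simp at this
    exact hx this
  have hzx : π * z = x * (1 - Complex.I) / 2 := by
    rw [hz]
    field_simp
  have h := Complex.hasSum_re ((hasSum_pi_mul_tan hzc).mul_left (1 / (π * x) : ℂ))
  have hval : ((1 / (π * x) : ℂ) * (π * Complex.tan (π * z))).re =
      Real.sin x / (x * (Real.cosh x + Real.cos x)) := by
    have : (1 / (π * x) : ℂ) * (π * Complex.tan (π * z)) =
        ((1 / x : ℝ) : ℂ) * Complex.tan (π * z) := by
      push_cast
      field_simp
    rw [this, Complex.re_ofReal_mul, hzx, re_tan_mul_one_sub_I_div_two, div_mul_div_comm, one_mul]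
  rw [hval] at h
  refine h.congr_fun fun k => ?_
  rw [tanTerm]
  congr 1
  have hden : ((2 * k + 1) ^ 2 - 4 * z ^ 2 : ℂ) =
      2 * Complex.I / π ^ 2 * ((x : ℂ) ^ 2 + tanPole k ^ 2) := by
    rw [tanPole_sq, hz]
    push_cast
    field_simp
    ring_nf
    simp only [Complex.I_sq]
    ring
  rw [hden, hz]
  generalize ((x : ℂ) ^ 2 + tanPole k ^ 2) = D
  rw [div_eq_mul_inv (8 * _), mul_inv (2 * Complex.I / (π : ℂ) ^ 2) D]
  field_simp
  linear_combination (-8) * D⁻¹ * Complex.I_sq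

theorem integral_sinc_mul_tanTerm (k : ℕ) :
    ∫ x, sinc x * tanTerm k x =
      4 / π * (1 / (2 * k + 1 : ℝ) ^ 2 -
        (-1) ^ k * Real.exp (-π / 2) ^ (2 * k + 1) / (2 * k + 1 : ℝ) ^ 2) := by
  have hinteg := integrable_inv_sq_add_tanPole_sq k
  have hinteg' : Integrable fun x : ℝ =>
      -2 * (1 + Complex.I) * ((sinc x : ℂ) * ((x : ℂ) ^ 2 + tanPole k ^ 2)⁻¹) := by
    refine Integrable.const_mul (hinteg.bdd_mul (c := 1) ?_ (.of_forall fun x => ?_)) _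
    · exact (Complex.continuous_ofReal.comp continuous_sinc).aestronglyMeasurable
    · rw [Complex.norm_real]
      exact abs_sinc_le_one x
  have hre : ∀ x : ℝ, sinc x * tanTerm k x =
      (-2 * (1 + Complex.I) * ((sinc x : ℂ) * ((x : ℂ) ^ 2 + tanPole k ^ 2)⁻¹)).re := by
    intro x
    rw [tanTerm, ← Complex.re_ofReal_mul]
    congr 1
    ring
  simp_rw [hre]
  have h := integral_re hinteg'
  simp only [RCLike.re_eq_complex_re] at h
  rw [h, integral_const_mul, integral_sinc_mul_inv_sq_add_sq (re_tanPole_pos k) hinteg, tanPole_sq,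
    exp_neg_tanPole]
  generalize (-1) ^ k * Real.exp (-π / 2) ^ (2 * k + 1) = E
  have hm : (2 * k + 1 : ℝ) ≠ 0 := by positivity
  have hm' : (2 * k + 1 : ℂ) ≠ 0 := by exact_mod_cast hm
  have hpi : (π : ℂ) ≠ 0 := by exact_mod_cast pi_ne_zero
  have : -2 * (1 + Complex.I) * (π / (-(((2 * k + 1) ^ 2 * π ^ 2 / 2 : ℝ) : ℂ) * Complex.I) *
      (1 - E * Complex.I)) =
      ((4 / (π * (2 * k + 1) ^ 2) : ℝ) : ℂ) * ((1 - Complex.I) * (1 - E * Complex.I)) := by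
    push_cast
    field_simp
    linear_combination (1 - E * Complex.I) * 4 * Complex.I_sq
  rw [this, Complex.re_ofReal_mul]
  simp
  field_simp

theorem hasSum_integral_sinc_mul_tanTerm :
    HasSum (fun k => ∫ x, sinc x * tanTerm k x)
      (∫ x, sinc x * (Real.sin x / (x * (Real.cosh x + Real.cos x)))) := by
  have hsum : Summable fun k : ℕ => (2 * k + 1 : ℝ) ^ (-(3 / 2) : ℝ) := by
    have h := (Real.summable_nat_rpow.2 (by norm_num : (-(3 / 2) : ℝ) < -1)).comp_injective
      (i := fun k : ℕ => 2 * k + 1) fun a b h => by simpa using h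
    refine h.congr fun k => ?_
    simp
  refine hasSum_integral_of_dominated_convergence
    (fun k x => (2 * k + 1 : ℝ) ^ (-(3 / 2) : ℝ) * (16 * (1 + ‖x‖ ^ 2) ^ (-(3 / 2) / 2 : ℝ)))
    (fun k => ?_) (fun k => .of_forall fun x => ?_)
    (.of_forall fun x => hsum.mul_right _) ?_ ?_
  · exact (continuous_sinc.mul (Complex.continuous_re.comp (continuous_const.mul
      (continuous_inv_sq_add_tanPole_sq k)))).aestronglyMeasurable
  · rw [norm_mul, Real.norm_eq_abs, Real.norm_eq_abs]
    have hpow : (1 + x ^ 2) ^ (-(3 / 2) / 2 : ℝ) =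
        (1 + x ^ 2) ^ (-(1 / 2) : ℝ) * (1 + x ^ 2) ^ (-(1 / 4) : ℝ) := by
      rw [← Real.rpow_add (by positivity)]
      norm_num
    calc |sinc x| * |tanTerm k x| ≤ _ :=
          mul_le_mul (abs_sinc_le x) (abs_tanTerm_le k x) (abs_nonneg _) (by positivity)
      _ = _ := by
          rw [Real.norm_eq_abs, sq_abs, hpow]
          ring
  · simp_rw [tsum_mul_right]
    exact ((integrable_rpow_neg_one_add_norm_sq (by norm_num)).const_mul _).const_mul _
  · filter_upwards [compl_mem_ae_iff.2 (measure_singleton (0 : ℝ))] with x hx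
    exact (hasSum_tanTerm hx).mul_left _

theorem russell_integral_11 :
    (∫ x in Set.Ioi (0:ℝ), (Real.sin x)^2 / (Real.cosh x + Real.cos x) * (1 / x^2)) +
      (2 / π) * ∫ x in Set.Ioo (0:ℝ) (Real.exp (-π/2)), Real.arctan x / x =
    π / 4 := by
  set I := ∫ x in Set.Ioi (0:ℝ), (Real.sin x)^2 / (Real.cosh x + Real.cos x) * (1 / x^2) with hI
  have heven : ∫ x, sinc x * (Real.sin x / (x * (Real.cosh x + Real.cos x))) = 2 * I := by
    rw [hI, ← integral_comp_abs]
    refine integral_congr_ae ?_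
    filter_upwards [compl_mem_ae_iff.2 (measure_singleton (0 : ℝ))] with x hx
    have hx : x ≠ 0 := hx
    have hsin : Real.sin |x| ^ 2 = Real.sin x ^ 2 := by
      rcases abs_choice x with h | h <;> simp [h]
    rw [sinc_of_ne_zero hx, hsin, Real.cosh_abs, Real.cos_abs, sq_abs]
    have := (cosh_add_cos_pos hx).ne'
    field_simp
  have hseries := hasSum_integral_sinc_mul_tanTerm
  simp_rw [integral_sinc_mul_tanTerm] at hseries
  have hy : Real.exp (-π / 2) < 1 := Real.exp_lt_one_iff.2 (by linarith [pi_pos])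
  have h := hseries.unique ((hasSum_one_div_odd_sq.sub
    (hasSum_setIntegral_arctan_div (Real.exp_pos _) hy)).mul_left (4 / π))
  rw [heven] at h
  have hI' : I = 2 / π * (π ^ 2 / 8 - ∫ x in Set.Ioo (0:ℝ) (Real.exp (-π/2)), Real.arctan x / x) := by
    linear_combination h / 2
  rw [hI']
  have := pi_ne_zero
  field_simp
  ring
end
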